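/- Conservativity for β-normal forms: in a functional EPTS, suppose Γ ⊢ A type and let M be a Dedukti term in β-normal form with ⟦Γ⟧ ⊢ M : T, where T = El_{s_A} ⟦A⟧ (with Γ ⊢ A : s_A) or T = U_A (when A is a top-sort). Then M is an invertible form, Γ ⊢ |M| : A in the EPTS, and ⟦|M|⟧ ≡_H M. -/

import Mathlib

namespace DKPaper

inductive Tm (C : Type) : Type
  | var : Nat → Tm C
  | const : C → List (Tm C) → Tm C
  | type : Tm C
  | kind : Tm C
  | app : Tm C → Tm C → Tm C
  | lam : Tm C → Tm C → Tm C
  | pi : Tm C → Tm C → Tm C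

namespace Tm
variable {C : Type}

def liftRen (ρ : Nat → Nat) : Nat → Nat
  | 0 => 0
  | n + 1 => ρ n + 1

def ren (ρ : Nat → Nat) : Tm C → Tm C
  | var n => var (ρ n)
  | const c Ms => const c (Ms.attach.map fun x => ren ρ x.1)
  | type => type
  | kind => kind
  | app M N => app (ren ρ M) (ren ρ N)
  | lam A M => lam (ren ρ A) (ren (liftRen ρ) M)
  | pi A B => pi (ren ρ A) (ren (liftRen ρ) B)
termination_by t => sizeOf t
decreasing_by
  all_goals simp_wf
  all_goals try omega
  all_goals (have h := List.sizeOf_lt_of_mem x.2; omega)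

def liftSub (σ : Nat → Tm C) : Nat → Tm C
  | 0 => var 0
  | n + 1 => ren Nat.succ (σ n)

def sub (σ : Nat → Tm C) : Tm C → Tm C
  | var n => σ n
  | const c Ms => const c (Ms.attach.map fun x => sub σ x.1)
  | type => type
  | kind => kind
  | app M N => app (sub σ M) (sub σ N)
  | lam A M => lam (sub σ A) (sub (liftSub σ) M)
  | pi A B => pi (sub σ A) (sub (liftSub σ) B)
termination_by t => sizeOf t
decreasing_by
  all_goals simp_wf
  all_goals try omega
  all_goals (have h := List.sizeOf_lt_of_mem x.2; omega)

/-- Substitution of `N` for the variable of de Bruijn index `k` (the usual `M{N/x}`). -/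
def substAt (k : Nat) (N : Tm C) : Tm C → Tm C :=
  sub fun n => if n < k then var n else if n = k then ren (· + k) N else var (n - 1)

end Tm

/-! ## Signatures, rewrite rules, rewriting -/

/-- An entry `c[Δ] : A` of a signature: head constant, telescope (in declaration
order, each entry a type under the previous ones), and the type. -/
abbrev Sig (C : Type) := Set (C × List (Tm C) × Tm C)

/-- A rewrite rule `c[l⃗] ↪ r`: head constant, list of left-hand side argument
patterns (free de Bruijn variables are the pattern variables), right-hand side. -/
abbrev Rules (C : Type) := Set (C × List (Tm C) × Tm C)

variable {C : Type}

/-- Closure of a root relation under all term-forming contexts. -/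
inductive Cong (r : Tm C → Tm C → Prop) : Tm C → Tm C → Prop
  | base {M N} : r M N → Cong r M N
  | appL {M M' N} : Cong r M M' → Cong r (.app M N) (.app M' N)
  | appR {M N N'} : Cong r N N' → Cong r (.app M N) (.app M N')
  | lamA {A A' M} : Cong r A A' → Cong r (.lam A M) (.lam A' M)
  | lamM {A M M'} : Cong r M M' → Cong r (.lam A M) (.lam A M')
  | piA {A A' B} : Cong r A A' → Cong r (.pi A B) (.pi A' B)
  | piB {A B B'} : Cong r B B' → Cong r (.pi A B) (.pi A B')
  | constArg {c l₁ M M' l₂} : Cong r M M' →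
      Cong r (.const c (l₁ ++ M :: l₂)) (.const c (l₁ ++ M' :: l₂))

/-- Root β-reduction. -/
def BetaRoot : Tm C → Tm C → Prop := fun M N =>
  ∃ A P Q, M = .app (.lam A P) Q ∧ N = Tm.substAt 0 Q P

/-- Root reduction by a rule of `R`: a substitution instance of some rule. -/
def RuleRoot (R : Rules C) : Tm C → Tm C → Prop := fun M N =>
  ∃ rl ∈ R, ∃ σ : Nat → Tm C,
    M = Tm.sub σ (.const rl.1 rl.2.1) ∧ N = Tm.sub σ rl.2.2

/-- One-step β-reduction `↪_β`. -/
def Beta : Tm C → Tm C → Prop := Cong BetaRoot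

/-- One-step reduction by the rules of `R` only (no β). -/
def RStep (R : Rules C) : Tm C → Tm C → Prop := Cong (RuleRoot R)

/-- One-step reduction `↪_{β𝓡}`. -/
def Step (R : Rules C) : Tm C → Tm C → Prop :=
  Cong (fun M N => BetaRoot M N ∨ RuleRoot R M N)

/-- The conversion `≡_{β𝓡}` generated by `↪_{β𝓡}`. -/
def Conv (R : Rules C) : Tm C → Tm C → Prop := Relation.EqvGen (Step R)

/-- Confluence of an abstract reduction relation. -/
def Confluent {α : Type _} (r : α → α → Prop) : Prop :=
  ∀ a b c, Relation.ReflTransGen r a b → Relation.ReflTransGen r a c →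
    ∃ d, Relation.ReflTransGen r b d ∧ Relation.ReflTransGen r c d

/-- `M` is in β-normal form. -/
def BetaNormal (M : Tm C) : Prop := ∀ N, ¬ Beta M N

/-- Strong normalization of a relation at a point: no infinite `r`-sequence starts at `a`. -/
def SN {α : Type _} (r : α → α → Prop) (a : α) : Prop := Acc (fun x y => r y x) a


/-! ## Dedukti typing -/

/-- `IsDKSort s` means `s` is `TYPE` or `KIND`. -/
def IsDKSort (s : Tm C) : Prop := s = Tm.type ∨ s = Tm.kind

/-- `A{M⃗}`: simultaneous instantiation of the telescope variables by the arguments. -/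
def instArgs (Ms : List (Tm C)) (A : Tm C) : Tm C :=
  Tm.sub (fun n => Ms.reverse.getD n (Tm.var (n - Ms.length))) A

/-- Instantiate the first variable of the (remaining) telescope `Δ` with `M`. -/
def instTele (M : Tm C) (Δ : List (Tm C)) : List (Tm C) :=
  Δ.mapIdx fun i B => Tm.substAt i M B

mutual
/-- Well-formed contexts `Σ;Γ well-formed` (de Bruijn: last declaration first). -/
inductive Wf (S : Sig C) (R : Rules C) : List (Tm C) → Prop
  | empty : Wf S R []
  | decl {Γ A} : Typed S R Γ A Tm.type → Wf S R (A :: Γ)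

/-- The Dedukti typing judgment `Σ;Γ ⊢ M : A`. -/
inductive Typed (S : Sig C) (R : Rules C) : List (Tm C) → Tm C → Tm C → Prop
  | sort {Γ} : Wf S R Γ → Typed S R Γ Tm.type Tm.kind
  | var {Γ n A} : Wf S R Γ → Γ[n]? = some A →
      Typed S R Γ (Tm.var n) (Tm.ren (· + (n + 1)) A)
  | cons {Γ c Δ A s Ms} : (c, Δ, A) ∈ S → Typed S R Δ.reverse A s → IsDKSort s →
      TypedArgs S R Γ Ms Δ → Typed S R Γ (Tm.const c Ms) (instArgs Ms A)
  | conv {Γ M A B s} : Typed S R Γ M A → Typed S R Γ B s → IsDKSort s →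
      Conv R A B → Typed S R Γ M B
  | prod {Γ A B s} : Typed S R Γ A Tm.type → Typed S R (A :: Γ) B s → IsDKSort s →
      Typed S R Γ (Tm.pi A B) s
  | abs {Γ A B s M} : Typed S R Γ A Tm.type → Typed S R (A :: Γ) B s → IsDKSort s →
      Typed S R (A :: Γ) M B → Typed S R Γ (Tm.lam A M) (Tm.pi A B)
  | app {Γ M N A B} : Typed S R Γ M (Tm.pi A B) → Typed S R Γ N A →
      Typed S R Γ (Tm.app M N) (Tm.substAt 0 N B)

/-- `Σ;Γ ⊢ M⃗ : Δ`: the arguments fit the telescope. -/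
inductive TypedArgs (S : Sig C) (R : Rules C) : List (Tm C) → List (Tm C) → List (Tm C) → Prop
  | nil {Γ} : TypedArgs S R Γ [] []
  | cons {Γ M Ms A Δ} : Typed S R Γ M A → TypedArgs S R Γ Ms (instTele M Δ) →
      TypedArgs S R Γ (M :: Ms) (A :: Δ)
end

/-! ## Type-level and object-level constants, syntactic classes -/

/-- Types of the form `Πx⃗:B⃗.TYPE`. -/
inductive IsKindShape : Tm C → Prop
  | type : IsKindShape Tm.type
  | pi {A K} : IsKindShape K → IsKindShape (Tm.pi A K)

/-- `c` is a type-level constant of the signature `S`. -/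
def TypeLevel (S : Sig C) (c : C) : Prop := ∃ Δ A, (c, Δ, A) ∈ S ∧ IsKindShape A

/-- `c` is an object-level constant of the signature `S`: it is declared, and not type-level. -/
def ObjLevel (S : Sig C) (c : C) : Prop := (∃ Δ A, (c, Δ, A) ∈ S) ∧ ¬ TypeLevel S c

mutual
/-- Kinds: `K ::= TYPE | Πx:T.K`. -/
inductive IsKind (S : Sig C) : Tm C → Prop
  | type : IsKind S Tm.type
  | pi {T K} : IsTypeFam S T → IsKind S K → IsKind S (Tm.pi T K)

/-- Type families: `T ::= α[O⃗] | T O | λx:T.T | Πx:T.T` with `α` type-level. -/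
inductive IsTypeFam (S : Sig C) : Tm C → Prop
  | const {c Os} : TypeLevel S c → (∀ O ∈ Os, IsObj S O) → IsTypeFam S (Tm.const c Os)
  | app {T O} : IsTypeFam S T → IsObj S O → IsTypeFam S (Tm.app T O)
  | lam {T₁ T₂} : IsTypeFam S T₁ → IsTypeFam S T₂ → IsTypeFam S (Tm.lam T₁ T₂)
  | pi {T₁ T₂} : IsTypeFam S T₁ → IsTypeFam S T₂ → IsTypeFam S (Tm.pi T₁ T₂)

/-- Objects: `O ::= x | a[O⃗] | O O | λx:T.O` with `a` object-level. -/
inductive IsObj (S : Sig C) : Tm C → Prop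
  | var {n} : IsObj S (Tm.var n)
  | const {c Os} : ObjLevel S c → (∀ O ∈ Os, IsObj S O) → IsObj S (Tm.const c Os)
  | app {O₁ O₂} : IsObj S O₁ → IsObj S O₂ → IsObj S (Tm.app O₁ O₂)
  | lam {T O} : IsTypeFam S T → IsObj S O → IsObj S (Tm.lam T O)
end

mutual
/-- Pre-kinds: `L ::= TYPE | Πx:R.L`. -/
inductive PreKind (S : Sig C) : Tm C → Prop
  | type : PreKind S Tm.type
  | pi {R L} : PreTypeFam S R → PreKind S L → PreKind S (Tm.pi R L)

/-- Pre-type families: `R ::= α[M⃗] | R N | λx:A.R | Πx:R.R` with `α` type-level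
and `M⃗`, `N`, `A` arbitrary. -/
inductive PreTypeFam (S : Sig C) : Tm C → Prop
  | const {c Ms} : TypeLevel S c → PreTypeFam S (Tm.const c Ms)
  | app {R N} : PreTypeFam S R → PreTypeFam S (Tm.app R N)
  | lam {A R} : PreTypeFam S R → PreTypeFam S (Tm.lam A R)
  | pi {R₁ R₂} : PreTypeFam S R₁ → PreTypeFam S R₂ → PreTypeFam S (Tm.pi R₁ R₂)
end

/-- A rewrite rule is type-level when its head constant is type-level. -/
def TypeLevelRule (S : Sig C) (rl : C × List (Tm C) × Tm C) : Prop := TypeLevel S rl.1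

/-- The grammar `R ::= α[M⃗] | R N | λx:A.R` used to define arity preservation. -/
inductive APShape (S : Sig C) : Tm C → Prop
  | const {c Ms} : TypeLevel S c → APShape S (Tm.const c Ms)
  | app {R N} : APShape S R → APShape S (Tm.app R N)
  | lam {A R} : APShape S R → APShape S (Tm.lam A R)

/-- `𝓡` is arity preserving (w.r.t. `Σ`). -/
def ArityPreserving (S : Sig C) (R : Rules C) : Prop :=
  ∀ rl ∈ R, TypeLevelRule S rl → APShape S rl.2.2

/-- `𝓡` is well-formed (w.r.t. `Σ`): right-hand sides of type-level rules are in
the grammar `R ::= α[M⃗] | R N | λx:B.R | Πx:R.R`. -/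
def RulesWellFormed (S : Sig C) (R : Rules C) : Prop :=
  ∀ rl ∈ R, TypeLevelRule S rl → PreTypeFam S rl.2.2

/-! ## Simple types and the erasure maps -/

/-- Simple types `σ ::= * | σ → σ`. -/
inductive STy : Type
  | star : STy
  | arr : STy → STy → STy
deriving DecidableEq

open Classical in
/-- The partial type erasure `⌈·⌉` from Dedukti terms to simple types. -/
noncomputable def tyErase (S : Sig C) : Tm C → Option STy
  | Tm.type => some STy.star
  | Tm.const c _ => if TypeLevel S c then some STy.star else none
  | Tm.pi A B => do return STy.arr (← tyErase S A) (← tyErase S B)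
  | Tm.app A _ => tyErase S A
  | Tm.lam _ B => tyErase S B
  | Tm.var _ => none
  | Tm.kind => none

/-- Untyped λ-terms with constants in `K` (the target of the term erasure). -/
inductive LTm (K : Type) : Type
  | var : Nat → LTm K
  | const : K → LTm K
  | app : LTm K → LTm K → LTm K
  | lam : LTm K → LTm K

namespace LTm
variable {K : Type}

def liftRen' (ρ : Nat → Nat) : Nat → Nat
  | 0 => 0
  | n + 1 => ρ n + 1

def ren (ρ : Nat → Nat) : LTm K → LTm K
  | var n => var (ρ n)
  | const k => const k
  | app M N => app (ren ρ M) (ren ρ N)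
  | lam M => lam (ren (liftRen' ρ) M)

/-- Shift free variables `≥ d` up by one. -/
def shiftAbove (d : Nat) : LTm K → LTm K :=
  ren fun n => if n < d then n else n + 1

def liftSub (σ : Nat → LTm K) : Nat → LTm K
  | 0 => var 0
  | n + 1 => ren Nat.succ (σ n)

def sub (σ : Nat → LTm K) : LTm K → LTm K
  | var n => σ n
  | const k => const k
  | app M N => app (sub σ M) (sub σ N)
  | lam M => lam (sub (liftSub σ) M)

/-- Substitution `M{N/x}` for the variable of index `k`. -/
def substAt (k : Nat) (N : LTm K) : LTm K → LTm K :=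
  sub fun n => if n < k then var n else if n = k then ren (· + k) N else var (n - 1)

end LTm

/-- β-reduction for the (simply-typed) λ-calculus. -/
inductive LBeta {K : Type} : LTm K → LTm K → Prop
  | red {M N} : LBeta (LTm.app (LTm.lam M) N) (LTm.substAt 0 N M)
  | appL {M M' N} : LBeta M M' → LBeta (LTm.app M N) (LTm.app M' N)
  | appR {M N N'} : LBeta N N' → LBeta (LTm.app M N) (LTm.app M N')
  | lam {M M'} : LBeta M M' → LBeta (LTm.lam M) (LTm.lam M')

/-- The partial term erasure `|·|` from Dedukti terms into the λ-calculus with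
constants `C ⊕ STy` (`Sum.inr σ` being the constant `π_σ`). -/
noncomputable def erase (S : Sig C) : Tm C → Option (LTm (C ⊕ STy))
  | Tm.var n => some (LTm.var n)
  | Tm.const c Ms => do
      let ts ← Ms.attach.mapM fun x => erase S x.1
      return ts.foldl LTm.app (LTm.const (Sum.inl c))
  | Tm.app M N => do return LTm.app (← erase S M) (← erase S N)
  | Tm.lam A M => do
      return LTm.app (LTm.lam (LTm.lam (LTm.shiftAbove 1 (← erase S M)))) (← erase S A)
  | Tm.pi A B => do
      return LTm.app (LTm.app (LTm.const (Sum.inr (← tyErase S A))) (← erase S A))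
        (LTm.lam (← erase S B))
  | Tm.type => none
  | Tm.kind => none
termination_by t => sizeOf t
decreasing_by
  all_goals simp_wf
  all_goals try omega
  all_goals (have h := List.sizeOf_lt_of_mem x.2; omega)

/-- The type `* → (σ → *) → *` of the constant `π_σ`. -/
def piConstTy (σ : STy) : STy := STy.arr STy.star (STy.arr (STy.arr σ STy.star) STy.star)

/-- `⌈A₁⌉ → ... → ⌈Aₙ⌉ → ⌈A⌉`, as a relation (defined when all erasures are). -/
inductive EraseTele (S : Sig C) : List (Tm C) → Tm C → STy → Prop
  | nil {A σ} : tyErase S A = some σ → EraseTele S [] A σ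
  | cons {B Δ A τ σ} : tyErase S B = some τ → EraseTele S Δ A σ →
      EraseTele S (B :: Δ) A (STy.arr τ σ)

/-- The simply-typed constant context `Γ_π, ⌈Σ'⌉`: it declares `π_σ : * → (σ → *) → *`
for every simple type `σ`, and `c : ⌈A₁⌉ → ... → ⌈Aₙ⌉ → ⌈A⌉` for every
declaration `c[x₁:A₁,...,xₙ:Aₙ] : A` of `Σ'` (erasures being taken w.r.t. `S`). -/
inductive ConstTy (S : Sig C) (S' : Sig C) : C ⊕ STy → STy → Prop
  | piConst (σ : STy) : ConstTy S S' (Sum.inr σ) (piConstTy σ)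
  | const {c Δ A σ} : (c, Δ, A) ∈ S' → EraseTele S Δ A σ → ConstTy S S' (Sum.inl c) σ

/-- Typing in the simply-typed λ-calculus, with constants typed by `cty`. -/
inductive STTyped {K : Type} (cty : K → STy → Prop) : List STy → LTm K → STy → Prop
  | var {Γ n σ} : Γ[n]? = some σ → STTyped cty Γ (LTm.var n) σ
  | const {Γ k σ} : cty k σ → STTyped cty Γ (LTm.const k) σ
  | app {Γ M N σ τ} : STTyped cty Γ M (STy.arr σ τ) → STTyped cty Γ N σ →
      STTyped cty Γ (LTm.app M N) τ
  | lam {Γ M σ τ} : STTyped cty (σ :: Γ) M τ → STTyped cty Γ (LTm.lam M) (STy.arr σ τ)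

/-! ## Explicitly-typed Pure Type Systems (EPTS) -/

/-- EPTS terms (de Bruijn): `x | s | Π_{s₁,s₂}(A,[x]B) | λ_{s₁,s₂}(A,[x]B,[x]M) |
@_{s₁,s₂}(A,[x]B,M,N)`. -/
inductive ETm (S : Type) : Type
  | var : Nat → ETm S
  | sort : S → ETm S
  | pi : S → S → ETm S → ETm S → ETm S
  | lam : S → S → ETm S → ETm S → ETm S → ETm S
  | app : S → S → ETm S → ETm S → ETm S → ETm S → ETm S

namespace ETm
variable {S : Type}

def ren (ρ : Nat → Nat) : ETm S → ETm S
  | var n => var (ρ n)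
  | sort s => sort s
  | pi s₁ s₂ A B => pi s₁ s₂ (ren ρ A) (ren (Tm.liftRen ρ) B)
  | lam s₁ s₂ A B M => lam s₁ s₂ (ren ρ A) (ren (Tm.liftRen ρ) B) (ren (Tm.liftRen ρ) M)
  | app s₁ s₂ A B M N => app s₁ s₂ (ren ρ A) (ren (Tm.liftRen ρ) B) (ren ρ M) (ren ρ N)

def liftSub (σ : Nat → ETm S) : Nat → ETm S
  | 0 => var 0
  | n + 1 => ren Nat.succ (σ n)

def sub (σ : Nat → ETm S) : ETm S → ETm S
  | var n => σ n
  | sort s => sort s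
  | pi s₁ s₂ A B => pi s₁ s₂ (sub σ A) (sub (liftSub σ) B)
  | lam s₁ s₂ A B M => lam s₁ s₂ (sub σ A) (sub (liftSub σ) B) (sub (liftSub σ) M)
  | app s₁ s₂ A B M N => app s₁ s₂ (sub σ A) (sub (liftSub σ) B) (sub σ M) (sub σ N)

/-- Substitution `M{N/x}` for the variable of de Bruijn index `k`. -/
def substAt (k : Nat) (N : ETm S) : ETm S → ETm S :=
  sub fun n => if n < k then var n else if n = k then ren (· + k) N else var (n - 1)

end ETm

variable {S : Type}

/-- Closure of a root relation under all EPTS term-forming contexts. -/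
inductive ECong (r : ETm S → ETm S → Prop) : ETm S → ETm S → Prop
  | base {M N} : r M N → ECong r M N
  | piA {s₁ s₂ A A' B} : ECong r A A' → ECong r (.pi s₁ s₂ A B) (.pi s₁ s₂ A' B)
  | piB {s₁ s₂ A B B'} : ECong r B B' → ECong r (.pi s₁ s₂ A B) (.pi s₁ s₂ A B')
  | lamA {s₁ s₂ A A' B M} : ECong r A A' → ECong r (.lam s₁ s₂ A B M) (.lam s₁ s₂ A' B M)
  | lamB {s₁ s₂ A B B' M} : ECong r B B' → ECong r (.lam s₁ s₂ A B M) (.lam s₁ s₂ A B' M)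
  | lamM {s₁ s₂ A B M M'} : ECong r M M' → ECong r (.lam s₁ s₂ A B M) (.lam s₁ s₂ A B M')
  | appA {s₁ s₂ A A' B M N} : ECong r A A' → ECong r (.app s₁ s₂ A B M N) (.app s₁ s₂ A' B M N)
  | appB {s₁ s₂ A B B' M N} : ECong r B B' → ECong r (.app s₁ s₂ A B M N) (.app s₁ s₂ A B' M N)
  | appM {s₁ s₂ A B M M' N} : ECong r M M' → ECong r (.app s₁ s₂ A B M N) (.app s₁ s₂ A B M' N)
  | appN {s₁ s₂ A B M N N'} : ECong r N N' → ECong r (.app s₁ s₂ A B M N) (.app s₁ s₂ A B M N')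

/-- Root β-reduction of the EPTS (linearized rule, one instance per `(s₁,s₂,s₃) ∈ ℛ`):
`@_{s₁,s₂}(A,[x]B, λ_{s₁,s₂}(A',[x]B',[x]M), N) ↪ M{N/x}`. -/
def EBetaRoot (Rrel : S → S → S → Prop) : ETm S → ETm S → Prop := fun M N =>
  ∃ s₁ s₂ s₃ A B A' B' P Q, Rrel s₁ s₂ s₃ ∧
    M = ETm.app s₁ s₂ A B (ETm.lam s₁ s₂ A' B' P) Q ∧ N = ETm.substAt 0 Q P

/-- One-step EPTS reduction. -/
def EStep (Rrel : S → S → S → Prop) : ETm S → ETm S → Prop := ECong (EBetaRoot Rrel)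

/-- EPTS conversion `≡`. -/
def EConv (Rrel : S → S → S → Prop) : ETm S → ETm S → Prop := Relation.EqvGen (EStep Rrel)

mutual
/-- Well-formed EPTS contexts. -/
inductive EWf (Ar : S → S → Prop) (Rr : S → S → S → Prop) : List (ETm S) → Prop
  | empty : EWf Ar Rr []
  | decl {Γ A s} : ETyped Ar Rr Γ A (ETm.sort s) → EWf Ar Rr (A :: Γ)

/-- The EPTS typing judgment `Γ ⊢ M : A`. -/
inductive ETyped (Ar : S → S → Prop) (Rr : S → S → S → Prop) : List (ETm S) → ETm S → ETm S → Prop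
  | sort {Γ s₁ s₂} : EWf Ar Rr Γ → Ar s₁ s₂ → ETyped Ar Rr Γ (ETm.sort s₁) (ETm.sort s₂)
  | var {Γ n A} : EWf Ar Rr Γ → Γ[n]? = some A →
      ETyped Ar Rr Γ (ETm.var n) (ETm.ren (· + (n + 1)) A)
  | conv {Γ M A B s} : ETyped Ar Rr Γ M A → ETyped Ar Rr Γ B (ETm.sort s) →
      EConv Rr A B → ETyped Ar Rr Γ M B
  | pi {Γ s₁ s₂ s₃ A B} : Rr s₁ s₂ s₃ → ETyped Ar Rr Γ A (ETm.sort s₁) →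
      ETyped Ar Rr (A :: Γ) B (ETm.sort s₂) →
      ETyped Ar Rr Γ (ETm.pi s₁ s₂ A B) (ETm.sort s₃)
  | lam {Γ s₁ s₂ s₃ A B M} : Rr s₁ s₂ s₃ → ETyped Ar Rr Γ A (ETm.sort s₁) →
      ETyped Ar Rr (A :: Γ) B (ETm.sort s₂) → ETyped Ar Rr (A :: Γ) M B →
      ETyped Ar Rr Γ (ETm.lam s₁ s₂ A B M) (ETm.pi s₁ s₂ A B)
  | app {Γ s₁ s₂ s₃ A B M N} : Rr s₁ s₂ s₃ → ETyped Ar Rr Γ A (ETm.sort s₁) →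
      ETyped Ar Rr (A :: Γ) B (ETm.sort s₂) → ETyped Ar Rr Γ N A →
      ETyped Ar Rr Γ M (ETm.pi s₁ s₂ A B) →
      ETyped Ar Rr Γ (ETm.app s₁ s₂ A B M N) (ETm.substAt 0 N B)
end

/-- `𝒜` and `ℛ` are functional relations. -/
def FunctionalSpec (Ar : S → S → Prop) (Rr : S → S → S → Prop) : Prop :=
  (∀ s t t', Ar s t → Ar s t' → t = t') ∧
  (∀ s₁ s₂ t t', Rr s₁ s₂ t → Rr s₁ s₂ t' → t = t')

/-- `s` is a top-sort. -/
def IsTopSort (Ar : S → S → Prop) (s : S) : Prop := ¬ ∃ s', Ar s s'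

/-- `Γ ⊢ A type`: `A` is a sort, or `Γ ⊢ A : s` for some sort `s`. -/
def ETypeJ (Ar : S → S → Prop) (Rr : S → S → S → Prop) (Γ : List (ETm S)) (A : ETm S) : Prop :=
  (∃ s, A = ETm.sort s) ∨ ∃ s, ETyped Ar Rr Γ A (ETm.sort s)

/-! ## (Implicit) Pure Type Systems -/

/-- PTS terms. -/
inductive PTm (S : Type) : Type
  | var : Nat → PTm S
  | sort : S → PTm S
  | pi : PTm S → PTm S → PTm S
  | lam : PTm S → PTm S → PTm S
  | app : PTm S → PTm S → PTm S

namespace PTm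
variable {S : Type}

def ren (ρ : Nat → Nat) : PTm S → PTm S
  | var n => var (ρ n)
  | sort s => sort s
  | pi A B => pi (ren ρ A) (ren (Tm.liftRen ρ) B)
  | lam A M => lam (ren ρ A) (ren (Tm.liftRen ρ) M)
  | app M N => app (ren ρ M) (ren ρ N)

def liftSub (σ : Nat → PTm S) : Nat → PTm S
  | 0 => var 0
  | n + 1 => ren Nat.succ (σ n)

def sub (σ : Nat → PTm S) : PTm S → PTm S
  | var n => σ n
  | sort s => sort s
  | pi A B => pi (sub σ A) (sub (liftSub σ) B)
  | lam A M => lam (sub σ A) (sub (liftSub σ) M)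
  | app M N => app (sub σ M) (sub σ N)

def substAt (k : Nat) (N : PTm S) : PTm S → PTm S :=
  sub fun n => if n < k then var n else if n = k then ren (· + k) N else var (n - 1)

end PTm

/-- One-step β-reduction of PTS terms. -/
inductive PBeta : PTm S → PTm S → Prop
  | red {A M N} : PBeta (PTm.app (PTm.lam A M) N) (PTm.substAt 0 N M)
  | piA {A A' B} : PBeta A A' → PBeta (PTm.pi A B) (PTm.pi A' B)
  | piB {A B B'} : PBeta B B' → PBeta (PTm.pi A B) (PTm.pi A B')
  | lamA {A A' M} : PBeta A A' → PBeta (PTm.lam A M) (PTm.lam A' M)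
  | lamM {A M M'} : PBeta M M' → PBeta (PTm.lam A M) (PTm.lam A M')
  | appL {M M' N} : PBeta M M' → PBeta (PTm.app M N) (PTm.app M' N)
  | appR {M N N'} : PBeta N N' → PBeta (PTm.app M N) (PTm.app M N')

/-- PTS conversion. -/
def PConv : PTm S → PTm S → Prop := Relation.EqvGen PBeta

mutual
/-- Well-formed PTS contexts. -/
inductive PWf (Ar : S → S → Prop) (Rr : S → S → S → Prop) : List (PTm S) → Prop
  | empty : PWf Ar Rr []
  | decl {Γ A s} : PTyped Ar Rr Γ A (PTm.sort s) → PWf Ar Rr (A :: Γ)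

/-- The PTS typing judgment. -/
inductive PTyped (Ar : S → S → Prop) (Rr : S → S → S → Prop) : List (PTm S) → PTm S → PTm S → Prop
  | sort {Γ s₁ s₂} : PWf Ar Rr Γ → Ar s₁ s₂ → PTyped Ar Rr Γ (PTm.sort s₁) (PTm.sort s₂)
  | var {Γ n A} : PWf Ar Rr Γ → Γ[n]? = some A →
      PTyped Ar Rr Γ (PTm.var n) (PTm.ren (· + (n + 1)) A)
  | conv {Γ M A B s} : PTyped Ar Rr Γ M A → PTyped Ar Rr Γ B (PTm.sort s) →
      PConv A B → PTyped Ar Rr Γ M B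
  | pi {Γ s₁ s₂ s₃ A B} : Rr s₁ s₂ s₃ → PTyped Ar Rr Γ A (PTm.sort s₁) →
      PTyped Ar Rr (A :: Γ) B (PTm.sort s₂) →
      PTyped Ar Rr Γ (PTm.pi A B) (PTm.sort s₃)
  | lam {Γ s₁ s₂ s₃ A B M} : Rr s₁ s₂ s₃ → PTyped Ar Rr Γ A (PTm.sort s₁) →
      PTyped Ar Rr (A :: Γ) B (PTm.sort s₂) → PTyped Ar Rr (A :: Γ) M B →
      PTyped Ar Rr Γ (PTm.lam A M) (PTm.pi A B)
  | app {Γ A B M N} : PTyped Ar Rr Γ M (PTm.pi A B) → PTyped Ar Rr Γ N A →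
      PTyped Ar Rr Γ (PTm.app M N) (PTm.substAt 0 N B)
end

/-- `Γ ⊢_PTS A type`. -/
def PTypeJ (Ar : S → S → Prop) (Rr : S → S → S → Prop) (Γ : List (PTm S)) (A : PTm S) : Prop :=
  (∃ s, A = PTm.sort s) ∨ ∃ s, PTyped Ar Rr Γ A (PTm.sort s)

/-- The natural erasure from EPTS terms to PTS terms. -/
def epsErase : ETm S → PTm S
  | ETm.var n => PTm.var n
  | ETm.sort s => PTm.sort s
  | ETm.pi _ _ A B => PTm.pi (epsErase A) (epsErase B)
  | ETm.lam _ _ A _ M => PTm.lam (epsErase A) (epsErase M)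
  | ETm.app _ _ _ _ M N => PTm.app (epsErase M) (epsErase N)

/-! ## The encoding of EPTSs in Dedukti -/

/-- The constants of the theory `(Σ_EPTS, 𝓡_EPTS)`. -/
inductive EConst (S : Type) : Type
  | U : S → EConst S
  | El : S → EConst S
  | u : S → EConst S
  | Prod : S → S → EConst S
  | abs : S → S → EConst S
  | app : S → S → EConst S

/-- `U_s`. -/
def Ucon (s : S) : Tm (EConst S) := Tm.const (EConst.U s) []
/-- `El_s A`. -/
def Elcon (s : S) (A : Tm (EConst S)) : Tm (EConst S) := Tm.const (EConst.El s) [A]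
/-- `u_s`. -/
def ucon (s : S) : Tm (EConst S) := Tm.const (EConst.u s) []
/-- `Prod_{s₁,s₂} A B`. -/
def ProdC (s₁ s₂ : S) (A B : Tm (EConst S)) : Tm (EConst S) :=
  Tm.const (EConst.Prod s₁ s₂) [A, B]
/-- `abs_{s₁,s₂} A B M`. -/
def absC (s₁ s₂ : S) (A B M : Tm (EConst S)) : Tm (EConst S) :=
  Tm.const (EConst.abs s₁ s₂) [A, B, M]
/-- `app_{s₁,s₂} A B M N`. -/
def appC (s₁ s₂ : S) (A B M N : Tm (EConst S)) : Tm (EConst S) :=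
  Tm.const (EConst.app s₁ s₂) [A, B, M, N]

/-- The signature `Σ_EPTS` (telescopes in de Bruijn form). -/
inductive SigEPTSMem (Ar : S → S → Prop) (Rr : S → S → S → Prop) :
    EConst S × List (Tm (EConst S)) × Tm (EConst S) → Prop
  | U (s : S) : SigEPTSMem Ar Rr (EConst.U s, [], Tm.type)
  | El (s : S) : SigEPTSMem Ar Rr (EConst.El s, [Ucon s], Tm.type)
  | u {s₁ s₂} : Ar s₁ s₂ → SigEPTSMem Ar Rr (EConst.u s₁, [], Ucon s₂)
  | Prod {s₁ s₂ s₃} : Rr s₁ s₂ s₃ →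
      SigEPTSMem Ar Rr (EConst.Prod s₁ s₂,
        [Ucon s₁, Tm.pi (Elcon s₁ (Tm.var 0)) (Ucon s₂)],
        Ucon s₃)
  | abs {s₁ s₂ s₃} : Rr s₁ s₂ s₃ →
      SigEPTSMem Ar Rr (EConst.abs s₁ s₂,
        [Ucon s₁, Tm.pi (Elcon s₁ (Tm.var 0)) (Ucon s₂),
         Tm.pi (Elcon s₁ (Tm.var 1)) (Elcon s₂ (Tm.app (Tm.var 1) (Tm.var 0)))],
        Elcon s₃ (ProdC s₁ s₂ (Tm.var 2) (Tm.var 1)))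
  | app {s₁ s₂ s₃} : Rr s₁ s₂ s₃ →
      SigEPTSMem Ar Rr (EConst.app s₁ s₂,
        [Ucon s₁, Tm.pi (Elcon s₁ (Tm.var 0)) (Ucon s₂),
         Elcon s₃ (ProdC s₁ s₂ (Tm.var 1) (Tm.var 0)),
         Elcon s₁ (Tm.var 2)],
        Elcon s₂ (Tm.app (Tm.var 2) (Tm.var 0)))

/-- `Σ_EPTS` as a signature. -/
def sigEPTS (Ar : S → S → Prop) (Rr : S → S → S → Prop) : Sig (EConst S) :=
  fun e => SigEPTSMem Ar Rr e

/-- The rules `El_{s₂} u_{s₁} ↪ U_{s₁}` for `(s₁,s₂) ∈ 𝒜`. -/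
inductive URulesMem (Ar : S → S → Prop) :
    EConst S × List (Tm (EConst S)) × Tm (EConst S) → Prop
  | u_red {s₁ s₂} : Ar s₁ s₂ → URulesMem Ar (EConst.El s₂, [ucon s₁], Ucon s₁)

/-- The rules `app_{s₁,s₂} A B (abs_{s₁,s₂} A' B' M) N ↪ M N` for `(s₁,s₂,s₃) ∈ ℛ`
(pattern variables `A,B,A',B',M,N` are the de Bruijn variables `0,…,5`). -/
inductive BetaRulesMem (Rr : S → S → S → Prop) :
    EConst S × List (Tm (EConst S)) × Tm (EConst S) → Prop
  | beta {s₁ s₂ s₃} : Rr s₁ s₂ s₃ →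
      BetaRulesMem Rr (EConst.app s₁ s₂,
        [Tm.var 0, Tm.var 1, absC s₁ s₂ (Tm.var 2) (Tm.var 3) (Tm.var 4), Tm.var 5],
        Tm.app (Tm.var 4) (Tm.var 5))

/-- The `u_{s₁}`-red rules as a rule set. -/
def uRules (Ar : S → S → Prop) : Rules (EConst S) := fun e => URulesMem Ar e

/-- The `beta_{s₁,s₂}` rules as a rule set. -/
def betaRules (Rr : S → S → S → Prop) : Rules (EConst S) := fun e => BetaRulesMem Rr e

/-- The rewrite system `𝓡_EPTS`. -/
def rulesEPTS (Ar : S → S → Prop) (Rr : S → S → S → Prop) : Rules (EConst S) :=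
  uRules Ar ∪ betaRules Rr

/-- The translation `⟦·⟧` from EPTS terms to Dedukti terms. -/
def trans : ETm S → Tm (EConst S)
  | ETm.var n => Tm.var n
  | ETm.sort s => ucon s
  | ETm.pi s₁ s₂ A B =>
      ProdC s₁ s₂ (trans A) (Tm.lam (Elcon s₁ (trans A)) (trans B))
  | ETm.lam s₁ s₂ A B M =>
      absC s₁ s₂ (trans A) (Tm.lam (Elcon s₁ (trans A)) (trans B))
        (Tm.lam (Elcon s₁ (trans A)) (trans M))
  | ETm.app s₁ s₂ A B M N =>
      appC s₁ s₂ (trans A) (Tm.lam (Elcon s₁ (trans A)) (trans B)) (trans M) (trans N)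

/-- The translation `⟦·⟧` on (well-formed) contexts: `⟦Γ, x:A⟧ = ⟦Γ⟧, x : El_{s_A} ⟦A⟧`
where `Γ ⊢ A : s_A`. -/
inductive TransCtx (Ar : S → S → Prop) (Rr : S → S → S → Prop) :
    List (ETm S) → List (Tm (EConst S)) → Prop
  | nil : TransCtx Ar Rr [] []
  | cons {Γ Δ A sA} : TransCtx Ar Rr Γ Δ → ETyped Ar Rr Γ A (ETm.sort sA) →
      TransCtx Ar Rr (A :: Γ) (Elcon sA (trans A) :: Δ)

/-- Invertible forms. -/
inductive Invertible : Tm (EConst S) → Prop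
  | var {n} : Invertible (Tm.var n)
  | u {s} : Invertible (ucon s)
  | abs {s₁ s₂ A T₁ B T₂ M} : Invertible A → Invertible B → Invertible M →
      Invertible (absC s₁ s₂ A (Tm.lam T₁ B) (Tm.lam T₂ M))
  | beta {T M N} : Invertible M → Invertible N →
      Invertible (Tm.app (Tm.lam T M) N)
  | prod {s₁ s₂ A T₁ B} : Invertible A → Invertible B →
      Invertible (ProdC s₁ s₂ A (Tm.lam T₁ B))
  | app {s₁ s₂ A T₁ B M N} : Invertible A → Invertible B → Invertible M → Invertible N →
      Invertible (appC s₁ s₂ A (Tm.lam T₁ B) M N)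

/-- The inverse translation `|·|`, defined (at least) on invertible forms. -/
def inv : Tm (EConst S) → Option (ETm S)
  | Tm.var n => some (ETm.var n)
  | Tm.const (EConst.u s) [] => some (ETm.sort s)
  | Tm.app (Tm.lam _ M) N => do
      return ETm.substAt 0 (← inv N) (← inv M)
  | Tm.const (EConst.Prod s₁ s₂) [A, Tm.lam _ B] => do
      return ETm.pi s₁ s₂ (← inv A) (← inv B)
  | Tm.const (EConst.abs s₁ s₂) [A, Tm.lam _ B, Tm.lam _ M] => do
      return ETm.lam s₁ s₂ (← inv A) (← inv B) (← inv M)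
  | Tm.const (EConst.app s₁ s₂) [A, Tm.lam _ B, M, N] => do
      return ETm.app s₁ s₂ (← inv A) (← inv B) (← inv M) (← inv N)
  | _ => none
termination_by t => sizeOf t
decreasing_by
  all_goals simp_wf
  all_goals omega

/-- Hidden rewriting steps: a `↪_{β𝓡}` step inside the type annotation of a binder. -/
def HStep (R : Rules (EConst S)) : Tm (EConst S) → Tm (EConst S) → Prop :=
  Cong fun M N => ∃ A A' P, Step R A A' ∧ M = Tm.lam A P ∧ N = Tm.lam A' P

/-- The hidden conversion `≡_H`. -/
def HConv (R : Rules (EConst S)) : Tm (EConst S) → Tm (EConst S) → Prop :=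
  Relation.EqvGen (HStep R)


/-! ## Substitution calculus for Dedukti terms -/

namespace Tm

@[simp] theorem ren_var (ρ : Nat → Nat) (n : Nat) : ren ρ (var n : Tm C) = var (ρ n) := by
  rw [ren]

@[simp] theorem ren_const (ρ : Nat → Nat) (c : C) (Ms : List (Tm C)) :
    ren ρ (const c Ms) = const c (Ms.map (ren ρ)) := by
  rw [ren]; simp

@[simp] theorem ren_type (ρ : Nat → Nat) : ren ρ (type : Tm C) = type := by rw [ren]

@[simp] theorem ren_kind (ρ : Nat → Nat) : ren ρ (kind : Tm C) = kind := by rw [ren]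

@[simp] theorem ren_app (ρ : Nat → Nat) (M N : Tm C) :
    ren ρ (app M N) = app (ren ρ M) (ren ρ N) := by rw [ren]

@[simp] theorem ren_lam (ρ : Nat → Nat) (A M : Tm C) :
    ren ρ (lam A M) = lam (ren ρ A) (ren (liftRen ρ) M) := by rw [ren]

@[simp] theorem ren_pi (ρ : Nat → Nat) (A B : Tm C) :
    ren ρ (pi A B) = pi (ren ρ A) (ren (liftRen ρ) B) := by rw [ren]

@[simp] theorem sub_var (σ : Nat → Tm C) (n : Nat) : sub σ (var n) = σ n := by
  rw [sub]

@[simp] theorem sub_const (σ : Nat → Tm C) (c : C) (Ms : List (Tm C)) :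
    sub σ (const c Ms) = const c (Ms.map (sub σ)) := by
  rw [sub]; simp

@[simp] theorem sub_type (σ : Nat → Tm C) : sub σ type = type := by rw [sub]

@[simp] theorem sub_kind (σ : Nat → Tm C) : sub σ kind = kind := by rw [sub]

@[simp] theorem sub_app (σ : Nat → Tm C) (M N : Tm C) :
    sub σ (app M N) = app (sub σ M) (sub σ N) := by rw [sub]

@[simp] theorem sub_lam (σ : Nat → Tm C) (A M : Tm C) :
    sub σ (lam A M) = lam (sub σ A) (sub (liftSub σ) M) := by rw [sub]

@[simp] theorem sub_pi (σ : Nat → Tm C) (A B : Tm C) :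
    sub σ (pi A B) = pi (sub σ A) (sub (liftSub σ) B) := by rw [sub]

/-- Structural induction on terms, with the arguments of a constant as one hypothesis. -/
theorem structural_induction {P : Tm C → Prop} (var : ∀ n, P (var n))
    (const : ∀ c Ms, (∀ M ∈ Ms, P M) → P (const c Ms)) (type : P type) (kind : P kind)
    (app : ∀ M N, P M → P N → P (app M N)) (lam : ∀ A M, P A → P M → P (lam A M))
    (pi : ∀ A B, P A → P B → P (pi A B)) (t : Tm C) : P t := by
  induction h : sizeOf t using Nat.strong_induction_on generalizing t with
  | _ n ih =>
    subst h
    cases t with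
    | var n => exact var n
    | const c Ms =>
      refine const c Ms fun M hM => ih _ ?_ M rfl
      have := List.sizeOf_lt_of_mem hM
      simp; omega
    | type => exact type
    | kind => exact kind
    | app M N => exact app M N (ih _ (by simp; omega) M rfl) (ih _ (by simp) N rfl)
    | lam M N => exact lam M N (ih _ (by simp; omega) M rfl) (ih _ (by simp) N rfl)
    | pi M N => exact pi M N (ih _ (by simp; omega) M rfl) (ih _ (by simp) N rfl)

theorem liftRen_id : liftRen id = id := by
  funext n; cases n <;> rfl

theorem liftRen_comp (ρ ρ' : Nat → Nat) : liftRen (ρ ∘ ρ') = liftRen ρ ∘ liftRen ρ' := by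
  funext n; cases n <;> rfl

theorem ren_id (M : Tm C) : ren id M = M := by
  induction M using structural_induction with
  | const c Ms ih =>
    rw [ren_const, List.map_congr_left ih, List.map_id']
  | _ => simp_all [liftRen_id]

theorem ren_ren (ρ ρ' : Nat → Nat) (M : Tm C) : ren ρ (ren ρ' M) = ren (ρ ∘ ρ') M := by
  induction M using structural_induction generalizing ρ ρ' with
  | const c Ms ih => simpa using fun M hM => ih M hM ρ ρ'
  | _ => simp_all [liftRen_comp]

theorem liftSub_comp_liftRen (σ : Nat → Tm C) (ρ : Nat → Nat) :
    liftSub (σ ∘ ρ) = liftSub σ ∘ liftRen ρ := by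
  funext n; cases n <;> rfl

theorem sub_ren (σ : Nat → Tm C) (ρ : Nat → Nat) (M : Tm C) :
    sub σ (ren ρ M) = sub (σ ∘ ρ) M := by
  induction M using structural_induction generalizing σ ρ with
  | const c Ms ih => simpa using fun M hM => ih M hM σ ρ
  | _ => simp_all [liftSub_comp_liftRen]

theorem liftSub_ren_comp (ρ : Nat → Nat) (σ : Nat → Tm C) :
    liftSub (ren ρ ∘ σ) = ren (liftRen ρ) ∘ liftSub σ := by
  funext n; cases n
  · simp [liftSub, liftRen]
  · simp only [liftSub, Function.comp, ren_ren]; rfl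

theorem ren_sub (ρ : Nat → Nat) (σ : Nat → Tm C) (M : Tm C) :
    ren ρ (sub σ M) = sub (ren ρ ∘ σ) M := by
  induction M using structural_induction generalizing σ ρ with
  | const c Ms ih => simpa using fun M hM => ih M hM ρ σ
  | _ => simp_all [liftSub_ren_comp]

theorem liftSub_sub_comp (σ τ : Nat → Tm C) :
    liftSub (sub σ ∘ τ) = sub (liftSub σ) ∘ liftSub τ := by
  funext n; cases n
  · simp [liftSub]
  · simp only [liftSub, Function.comp, ren_sub, sub_ren]; rfl

theorem sub_sub (σ τ : Nat → Tm C) (M : Tm C) : sub σ (sub τ M) = sub (sub σ ∘ τ) M := by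
  induction M using structural_induction generalizing σ τ with
  | const c Ms ih => simpa using fun M hM => ih M hM σ τ
  | _ => simp_all [liftSub_sub_comp]

theorem liftSub_var : liftSub (var : Nat → Tm C) = var := by
  funext n; cases n <;> simp [liftSub]

theorem sub_var_eq_self (M : Tm C) : sub var M = M := by
  induction M using structural_induction with
  | const c Ms ih =>
    rw [sub_const, List.map_congr_left ih, List.map_id']
  | _ => simp_all [liftSub_var]

theorem liftSub_var_comp (ρ : Nat → Nat) :
    liftSub (fun n => (var (ρ n) : Tm C)) = fun n => var (liftRen ρ n) := by
  funext n; cases n <;> simp [liftSub, liftRen]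

theorem ren_eq_sub (ρ : Nat → Nat) (M : Tm C) : ren ρ M = sub (fun n => var (ρ n)) M := by
  have h := sub_ren var ρ M
  rwa [sub_var_eq_self] at h

/-- The substitution sending the variable `0` to `N` and lowering the other variables. -/
def inst (N : Tm C) : Nat → Tm C
  | 0 => N
  | n + 1 => var n

theorem substAt_zero (N M : Tm C) : substAt 0 N M = sub (inst N) M := by
  unfold substAt
  congr 1
  funext n
  cases n with
  | zero => exact ren_id N
  | succ n => simp [inst]

theorem sub_substAt_zero (σ : Nat → Tm C) (N M : Tm C) :
    sub σ (substAt 0 N M) = substAt 0 (sub σ N) (sub (liftSub σ) M) := by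
  rw [substAt_zero, substAt_zero, sub_sub, sub_sub]
  congr 1
  funext n
  cases n with
  | zero => simp [inst, liftSub]
  | succ n =>
    simp only [inst, liftSub, Function.comp, sub_var, sub_ren]
    exact (sub_var_eq_self _).symm

theorem ren_substAt_zero (ρ : Nat → Nat) (N M : Tm C) :
    ren ρ (substAt 0 N M) = substAt 0 (ren ρ N) (ren (liftRen ρ) M) := by
  simp only [ren_eq_sub, sub_substAt_zero, liftSub_var_comp]

end Tm

/-! ## Substitution calculus for EPTS terms -/

namespace ETm

theorem ren_id (M : ETm S) : ren id M = M := by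
  induction M <;> simp_all [ren, Tm.liftRen_id]

theorem ren_ren (ρ ρ' : Nat → Nat) (M : ETm S) : ren ρ (ren ρ' M) = ren (ρ ∘ ρ') M := by
  induction M generalizing ρ ρ' <;> simp_all [ren, Tm.liftRen_comp]

theorem liftSub_comp_liftRen (σ : Nat → ETm S) (ρ : Nat → Nat) :
    liftSub (σ ∘ ρ) = liftSub σ ∘ Tm.liftRen ρ := by
  funext n; cases n <;> rfl

theorem sub_ren (σ : Nat → ETm S) (ρ : Nat → Nat) (M : ETm S) :
    sub σ (ren ρ M) = sub (σ ∘ ρ) M := by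
  induction M generalizing σ ρ <;> simp_all [ren, sub, liftSub_comp_liftRen]

theorem liftSub_ren_comp (ρ : Nat → Nat) (σ : Nat → ETm S) :
    liftSub (ren ρ ∘ σ) = ren (Tm.liftRen ρ) ∘ liftSub σ := by
  funext n; cases n
  · simp [liftSub, ren, Tm.liftRen]
  · simp only [liftSub, Function.comp, ren_ren]; rfl

theorem ren_sub (ρ : Nat → Nat) (σ : Nat → ETm S) (M : ETm S) :
    ren ρ (sub σ M) = sub (ren ρ ∘ σ) M := by
  induction M generalizing σ ρ <;> simp_all [ren, sub, liftSub_ren_comp]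

theorem liftSub_sub_comp (σ τ : Nat → ETm S) :
    liftSub (sub σ ∘ τ) = sub (liftSub σ) ∘ liftSub τ := by
  funext n; cases n
  · simp [liftSub, sub]
  · simp only [liftSub, Function.comp, ren_sub, sub_ren]; rfl

theorem sub_sub (σ τ : Nat → ETm S) (M : ETm S) : sub σ (sub τ M) = sub (sub σ ∘ τ) M := by
  induction M generalizing σ τ <;> simp_all [sub, liftSub_sub_comp]

theorem liftSub_var : liftSub (var : Nat → ETm S) = var := by
  funext n; cases n <;> simp [liftSub, ren]

theorem sub_var_eq_self (M : ETm S) : sub var M = M := by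
  induction M <;> simp_all [sub, liftSub_var]

theorem liftSub_var_comp (ρ : Nat → Nat) :
    liftSub (fun n => (var (ρ n) : ETm S)) = fun n => var (Tm.liftRen ρ n) := by
  funext n; cases n <;> simp [liftSub, ren, Tm.liftRen]

theorem ren_eq_sub (ρ : Nat → Nat) (M : ETm S) : ren ρ M = sub (fun n => var (ρ n)) M := by
  have h := sub_ren var ρ M
  rwa [sub_var_eq_self] at h

/-- The substitution sending the variable `0` to `N` and lowering the other variables. -/
def inst (N : ETm S) : Nat → ETm S
  | 0 => N
  | n + 1 => var n

theorem substAt_zero (N M : ETm S) : substAt 0 N M = sub (inst N) M := by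
  unfold substAt
  congr 1
  funext n
  cases n with
  | zero => exact ren_id N
  | succ n => simp [inst]

theorem sub_substAt_zero (σ : Nat → ETm S) (N M : ETm S) :
    sub σ (substAt 0 N M) = substAt 0 (sub σ N) (sub (liftSub σ) M) := by
  rw [substAt_zero, substAt_zero, sub_sub, sub_sub]
  congr 1
  funext n
  cases n with
  | zero => simp [inst, liftSub, sub]
  | succ n =>
    simp only [inst, liftSub, Function.comp, sub, sub_ren]
    exact (sub_var_eq_self _).symm

theorem ren_substAt_zero (ρ : Nat → Nat) (N M : ETm S) :
    ren ρ (substAt 0 N M) = substAt 0 (ren ρ N) (ren (Tm.liftRen ρ) M) := by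
  simp only [ren_eq_sub, sub_substAt_zero, liftSub_var_comp]

end ETm

theorem trans_ren (ρ : Nat → Nat) (E : ETm S) : trans (ETm.ren ρ E) = Tm.ren ρ (trans E) := by
  induction E generalizing ρ <;> simp_all [trans, ETm.ren, ucon, ProdC, absC, appC, Elcon]

theorem trans_comp_liftSub (τ : Nat → ETm S) :
    trans ∘ ETm.liftSub τ = Tm.liftSub (trans ∘ τ) := by
  funext n; cases n <;> simp [ETm.liftSub, Tm.liftSub, trans, trans_ren]

theorem trans_sub (τ : Nat → ETm S) (E : ETm S) :
    trans (ETm.sub τ E) = Tm.sub (trans ∘ τ) (trans E) := by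
  induction E generalizing τ <;>
    simp_all [trans, ETm.sub, ucon, ProdC, absC, appC, Elcon, trans_comp_liftSub]

theorem trans_substAt_zero (N E : ETm S) :
    trans (ETm.substAt 0 N E) = Tm.substAt 0 (trans N) (trans E) := by
  rw [ETm.substAt_zero, Tm.substAt_zero, trans_sub]
  congr 1
  funext n; cases n <;> simp [ETm.inst, Tm.inst, trans]

/-! ## Parallel reduction and confluence -/

/-- Parallel reduction for `↪_{β𝓡}`. -/
inductive Par (Ar : S → S → Prop) (Rr : S → S → S → Prop) :
    Tm (EConst S) → Tm (EConst S) → Prop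
  | var {n} : Par Ar Rr (.var n) (.var n)
  | type : Par Ar Rr .type .type
  | kind : Par Ar Rr .kind .kind
  | const {c Ms Ms'} : Ms.length = Ms'.length → (∀ p ∈ Ms.zip Ms', Par Ar Rr p.1 p.2) →
      Par Ar Rr (.const c Ms) (.const c Ms')
  | app {M M' N N'} : Par Ar Rr M M' → Par Ar Rr N N' → Par Ar Rr (.app M N) (.app M' N')
  | lam {A A' M M'} : Par Ar Rr A A' → Par Ar Rr M M' → Par Ar Rr (.lam A M) (.lam A' M')
  | pi {A A' B B'} : Par Ar Rr A A' → Par Ar Rr B B' → Par Ar Rr (.pi A B) (.pi A' B')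
  | beta {A P P' Q Q'} : Par Ar Rr P P' → Par Ar Rr Q Q' →
      Par Ar Rr (.app (.lam A P) Q) (Tm.substAt 0 Q' P')
  | decode {s₁ s₂} : Ar s₁ s₂ → Par Ar Rr (Elcon s₂ (ucon s₁)) (Ucon s₁)
  | betaC {s₁ s₂ s₃ A B A' B' P P' Q Q'} : Rr s₁ s₂ s₃ → Par Ar Rr P P' → Par Ar Rr Q Q' →
      Par Ar Rr (appC s₁ s₂ A B (absC s₁ s₂ A' B' P) Q) (.app P' Q')

variable {Ar : S → S → Prop} {Rr : S → S → S → Prop}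

namespace Par

theorem const_of_forall₂ {c : EConst S} {Ms Ms' : List (Tm (EConst S))}
    (h : List.Forall₂ (Par Ar Rr) Ms Ms') : Par Ar Rr (.const c Ms) (.const c Ms') := by
  rw [List.forall₂_iff_zip] at h
  exact .const h.1 fun _ hp => h.2 hp

theorem refl (M : Tm (EConst S)) : Par Ar Rr M M := by
  induction M using Tm.structural_induction with
  | var n => exact .var
  | const c Ms ih => exact const_of_forall₂ (List.forall₂_same.2 ih)
  | type => exact .type
  | kind => exact .kind
  | app M N hM hN => exact .app hM hN
  | lam M N hM hN => exact .lam hM hN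
  | pi M N hM hN => exact .pi hM hN

theorem forall₂_map {f f' : Tm (EConst S) → Tm (EConst S)} {Ms Ms' : List (Tm (EConst S))}
    (hl : Ms.length = Ms'.length) (h : ∀ p ∈ Ms.zip Ms', Par Ar Rr (f p.1) (f' p.2)) :
    List.Forall₂ (Par Ar Rr) (Ms.map f) (Ms'.map f') := by
  rw [List.forall₂_map_left_iff, List.forall₂_map_right_iff, List.forall₂_iff_zip]
  exact ⟨hl, fun {a b} hab => h (a, b) hab⟩

theorem ren {M M' : Tm (EConst S)} (h : Par Ar Rr M M') (ρ : Nat → Nat) :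
    Par Ar Rr (Tm.ren ρ M) (Tm.ren ρ M') := by
  induction h generalizing ρ with
  | const hl _ ih =>
    simp only [Tm.ren_const]
    exact const_of_forall₂ (forall₂_map hl fun p hp => ih p hp ρ)
  | beta _ _ ihP ihQ =>
    simp only [Tm.ren_app, Tm.ren_lam, Tm.ren_substAt_zero]
    exact .beta (ihP _) (ihQ _)
  | decode h =>
    simpa [Elcon, ucon, Ucon] using Par.decode h
  | betaC h _ _ ihP ihQ =>
    simpa [appC, absC] using Par.betaC h (ihP ρ) (ihQ ρ)
  | var => exact refl _
  | type => exact refl _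
  | kind => exact refl _
  | app _ _ h₁ h₂ => simpa using Par.app (h₁ ρ) (h₂ ρ)
  | lam _ _ h₁ h₂ => simpa using Par.lam (h₁ ρ) (h₂ _)
  | pi _ _ h₁ h₂ => simpa using Par.pi (h₁ ρ) (h₂ _)

theorem liftSub {σ σ' : Nat → Tm (EConst S)} (h : ∀ n, Par Ar Rr (σ n) (σ' n)) (n : Nat) :
    Par Ar Rr (Tm.liftSub σ n) (Tm.liftSub σ' n) := by
  cases n with
  | zero => exact .var
  | succ n => exact (h n).ren _

theorem sub {M M' : Tm (EConst S)} (h : Par Ar Rr M M') {σ σ' : Nat → Tm (EConst S)}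
    (hσ : ∀ n, Par Ar Rr (σ n) (σ' n)) : Par Ar Rr (Tm.sub σ M) (Tm.sub σ' M') := by
  induction h generalizing σ σ' with
  | const hl _ ih =>
    simp only [Tm.sub_const]
    exact const_of_forall₂ (forall₂_map hl fun p hp => ih p hp hσ)
  | beta _ _ ihP ihQ =>
    simp only [Tm.sub_app, Tm.sub_lam, Tm.sub_substAt_zero]
    exact .beta (ihP (liftSub hσ)) (ihQ hσ)
  | decode h =>
    simpa [Elcon, ucon, Ucon] using Par.decode h
  | betaC h _ _ ihP ihQ =>
    simpa [appC, absC] using Par.betaC h (ihP hσ) (ihQ hσ)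
  | var => simpa using hσ _
  | type => simpa using Par.type
  | kind => simpa using Par.kind
  | app _ _ h₁ h₂ => simpa using Par.app (h₁ hσ) (h₂ hσ)
  | lam _ _ h₁ h₂ => simpa using Par.lam (h₁ hσ) (h₂ (liftSub hσ))
  | pi _ _ h₁ h₂ => simpa using Par.pi (h₁ hσ) (h₂ (liftSub hσ))

theorem substAt_zero {M M' N N' : Tm (EConst S)} (hM : Par Ar Rr M M') (hN : Par Ar Rr N N') :
    Par Ar Rr (Tm.substAt 0 N M) (Tm.substAt 0 N' M') := by
  rw [Tm.substAt_zero, Tm.substAt_zero]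
  refine hM.sub fun n => ?_
  cases n with
  | zero => exact hN
  | succ n => exact .var

/-! ### Inversion -/

theorem const_inv {c : EConst S} {Ms : List (Tm (EConst S))} {X : Tm (EConst S)}
    (h : Par Ar Rr (.const c Ms) X) :
    (∃ Ms', X = .const c Ms' ∧ List.Forall₂ (Par Ar Rr) Ms Ms') ∨
    (∃ s₁ s₂, c = .El s₂ ∧ Ms = [ucon s₁] ∧ Ar s₁ s₂ ∧ X = Ucon s₁) ∨
    (∃ s₁ s₂ s₃ A B A' B' P P' Q Q', c = .app s₁ s₂ ∧ Ms = [A, B, absC s₁ s₂ A' B' P, Q] ∧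
      Rr s₁ s₂ s₃ ∧ Par Ar Rr P P' ∧ Par Ar Rr Q Q' ∧ X = .app P' Q') := by
  generalize hY : Tm.const c Ms = Y at h
  cases h with
  | const hl h =>
    cases hY
    exact .inl ⟨_, rfl, List.forall₂_iff_zip.2 ⟨hl, fun {a b} hab => h (a, b) hab⟩⟩
  | decode h =>
    cases hY
    exact .inr (.inl ⟨_, _, rfl, rfl, h, rfl⟩)
  | betaC h hP hQ =>
    cases hY
    exact .inr (.inr ⟨_, _, _, _, _, _, _, _, _, _, _, rfl, rfl, h, hP, hQ, rfl⟩)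
  | _ => cases hY

theorem pi_inv {A B X : Tm (EConst S)} (h : Par Ar Rr (.pi A B) X) :
    ∃ A' B', X = .pi A' B' ∧ Par Ar Rr A A' ∧ Par Ar Rr B B' := by
  cases h with
  | pi hA hB => exact ⟨_, _, rfl, hA, hB⟩

theorem lam_inv {A B X : Tm (EConst S)} (h : Par Ar Rr (.lam A B) X) :
    ∃ A' B', X = .lam A' B' ∧ Par Ar Rr A A' ∧ Par Ar Rr B B' := by
  cases h with
  | lam hA hB => exact ⟨_, _, rfl, hA, hB⟩

theorem ucon_inv {s : S} {X : Tm (EConst S)} (hX : Par Ar Rr (ucon s) X) : X = ucon s := by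
  rcases const_inv hX with ⟨_, rfl, h⟩ | ⟨_, _, h, _⟩ | ⟨_, _, _, _, _, _, _, _, _, _, _, h, _⟩
  · cases h; rfl
  · cases h
  · cases h

theorem Ucon_inv {s : S} {X : Tm (EConst S)} (hX : Par Ar Rr (Ucon s) X) : X = Ucon s := by
  rcases const_inv hX with ⟨_, rfl, h⟩ | ⟨_, _, h, _⟩ | ⟨_, _, _, _, _, _, _, _, _, _, _, h, _⟩
  · cases h; rfl
  · cases h
  · cases h

theorem Elcon_inv {s : S} {A X : Tm (EConst S)} (hX : Par Ar Rr (Elcon s A) X) :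
    (∃ A', X = Elcon s A' ∧ Par Ar Rr A A') ∨ ∃ t, A = ucon t ∧ Ar t s ∧ X = Ucon t := by
  rcases const_inv hX with
    ⟨_, rfl, h⟩ | ⟨t, _, h, hA, ht, rfl⟩ | ⟨_, _, _, _, _, _, _, _, _, _, _, h, _⟩
  · rcases h with _ | ⟨h, _ | _⟩
    exact .inl ⟨_, rfl, h⟩
  · cases h; cases hA
    exact .inr ⟨t, rfl, ht, rfl⟩
  · cases h

theorem ProdC_inv {s₁ s₂ : S} {A B X : Tm (EConst S)} (hX : Par Ar Rr (ProdC s₁ s₂ A B) X) :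
    ∃ A' B', X = ProdC s₁ s₂ A' B' ∧ Par Ar Rr A A' ∧ Par Ar Rr B B' := by
  rcases const_inv hX with ⟨_, rfl, h⟩ | ⟨_, _, h, _⟩ | ⟨_, _, _, _, _, _, _, _, _, _, _, h, _⟩
  · rcases h with _ | ⟨hA, _ | ⟨hB, _ | _⟩⟩
    exact ⟨_, _, rfl, hA, hB⟩
  · cases h
  · cases h

theorem absC_inv {s₁ s₂ : S} {A B M X : Tm (EConst S)} (hX : Par Ar Rr (absC s₁ s₂ A B M) X) :
    ∃ A' B' M', X = absC s₁ s₂ A' B' M' ∧ Par Ar Rr A A' ∧ Par Ar Rr B B' ∧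
      Par Ar Rr M M' := by
  rcases const_inv hX with ⟨_, rfl, h⟩ | ⟨_, _, h, _⟩ | ⟨_, _, _, _, _, _, _, _, _, _, _, h, _⟩
  · rcases h with _ | ⟨hA, _ | ⟨hB, _ | ⟨hM, _ | _⟩⟩⟩
    exact ⟨_, _, _, rfl, hA, hB, hM⟩
  · cases h
  · cases h

theorem appC_inv {s₁ s₂ : S} {A B M N X : Tm (EConst S)}
    (hX : Par Ar Rr (appC s₁ s₂ A B M N) X) :
    (∃ A' B' M' N', X = appC s₁ s₂ A' B' M' N' ∧ Par Ar Rr A A' ∧ Par Ar Rr B B' ∧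
      Par Ar Rr M M' ∧ Par Ar Rr N N') ∨
    (∃ s₃ A' B' P P' N', M = absC s₁ s₂ A' B' P ∧ Rr s₁ s₂ s₃ ∧ Par Ar Rr P P' ∧
      Par Ar Rr N N' ∧ X = .app P' N') := by
  rcases const_inv hX with
    ⟨_, rfl, h⟩ | ⟨_, _, h, _⟩ | ⟨_, _, _, _, _, _, _, _, _, _, _, h, hM, hR, hP, hQ, rfl⟩
  · rcases h with _ | ⟨hA, _ | ⟨hB, _ | ⟨hM, _ | ⟨hN, _ | _⟩⟩⟩⟩
    exact .inl ⟨_, _, _, _, rfl, hA, hB, hM, hN⟩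
  · cases h
  · cases h; cases hM
    exact .inr ⟨_, _, _, _, _, _, rfl, hR, hP, hQ, rfl⟩

theorem app_inv {M N X : Tm (EConst S)} (h : Par Ar Rr (.app M N) X) :
    (∃ M' N', X = .app M' N' ∧ Par Ar Rr M M' ∧ Par Ar Rr N N') ∨
    (∃ A P P' N', M = .lam A P ∧ Par Ar Rr P P' ∧ Par Ar Rr N N' ∧
      X = Tm.substAt 0 N' P') := by
  cases h with
  | app hM hN => exact .inl ⟨_, _, rfl, hM, hN⟩
  | beta hP hN => exact .inr ⟨_, _, _, _, rfl, hP, hN, rfl⟩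

theorem exists_forall₂_of_forall_mem {Ms : List (Tm (EConst S))}
    (h : ∀ M ∈ Ms, ∃ D, ∀ N, Par Ar Rr M N → Par Ar Rr N D) :
    ∃ Ds, ∀ Ns, List.Forall₂ (Par Ar Rr) Ms Ns → List.Forall₂ (Par Ar Rr) Ns Ds := by
  induction Ms with
  | nil => exact ⟨[], fun Ns h => by cases h; exact .nil⟩
  | cons M Ms ih =>
    obtain ⟨Ds, hDs⟩ := ih fun N hN => h N (List.mem_cons_of_mem _ hN)
    obtain ⟨D, hD⟩ := h M List.mem_cons_self
    refine ⟨D :: Ds, fun Ns hNs => ?_⟩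
    cases hNs with
    | cons h₁ h₂ => exact .cons (hD _ h₁) (hDs _ h₂)

/-- The triangle property: `D` is the complete development of `M`. -/
theorem exists_development (M : Tm (EConst S)) : ∃ D, ∀ N, Par Ar Rr M N → Par Ar Rr N D := by
  induction h : sizeOf M using Nat.strong_induction_on generalizing M with
  | _ n ih =>
  subst h
  cases M with
  | var n => exact ⟨.var n, fun N hN => by cases hN; exact .var⟩
  | type => exact ⟨.type, fun N hN => by cases hN; exact .type⟩
  | kind => exact ⟨.kind, fun N hN => by cases hN; exact .kind⟩
  | lam A M =>
    obtain ⟨A₁, hA⟩ := ih _ (by simp; omega) A rfl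
    obtain ⟨M₁, hM⟩ := ih _ (by simp) M rfl
    refine ⟨.lam A₁ M₁, fun N hN => ?_⟩
    obtain ⟨_, _, rfl, h₁, h₂⟩ := lam_inv hN
    exact .lam (hA _ h₁) (hM _ h₂)
  | pi A M =>
    obtain ⟨A₁, hA⟩ := ih _ (by simp; omega) A rfl
    obtain ⟨M₁, hM⟩ := ih _ (by simp) M rfl
    refine ⟨.pi A₁ M₁, fun N hN => ?_⟩
    obtain ⟨_, _, rfl, h₁, h₂⟩ := pi_inv hN
    exact .pi (hA _ h₁) (hM _ h₂)
  | app M Q =>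
    obtain ⟨Q₁, hQ⟩ := ih _ (by simp) Q rfl
    by_cases hM : ∃ A P, M = .lam A P
    · obtain ⟨A, P, rfl⟩ := hM
      obtain ⟨P₁, hP⟩ := ih _ (by simp; omega) P rfl
      refine ⟨Tm.substAt 0 Q₁ P₁, fun N hN => ?_⟩
      rcases app_inv hN with ⟨_, _, rfl, h₁, h₂⟩ | ⟨_, _, _, _, hM, h₁, h₂, rfl⟩
      · obtain ⟨_, _, rfl, -, h₁⟩ := lam_inv h₁
        exact .beta (hP _ h₁) (hQ _ h₂)
      · cases hM
        exact (hP _ h₁).substAt_zero (hQ _ h₂)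
    · obtain ⟨M₁, hM₁⟩ := ih _ (by simp; omega) M rfl
      refine ⟨.app M₁ Q₁, fun N hN => ?_⟩
      rcases app_inv hN with ⟨_, _, rfl, h₁, h₂⟩ | ⟨_, _, _, _, hM', h₁, h₂, rfl⟩
      · exact .app (hM₁ _ h₁) (hQ _ h₂)
      · exact absurd ⟨_, _, hM'⟩ hM
  | const c Ms =>
    by_cases hu : ∃ s₁ s₂, c = .El s₂ ∧ Ms = [ucon s₁] ∧ Ar s₁ s₂
    · obtain ⟨s₁, s₂, rfl, rfl, hs⟩ := hu
      refine ⟨Ucon s₁, fun N hN => ?_⟩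
      rcases Elcon_inv hN with ⟨_, rfl, h⟩ | ⟨_, h, -, rfl⟩
      · cases ucon_inv h
        exact .decode hs
      · cases h
        exact refl _
    by_cases hb : ∃ s₁ s₂ s₃ A B A' B' P Q, c = .app s₁ s₂ ∧
        Ms = [A, B, absC s₁ s₂ A' B' P, Q] ∧ Rr s₁ s₂ s₃
    · obtain ⟨s₁, s₂, s₃, A, B, A', B', P, Q, rfl, rfl, hs⟩ := hb
      obtain ⟨P₁, hP⟩ := ih _ (by simp [absC]; omega) P rfl
      obtain ⟨Q₁, hQ⟩ := ih _ (by simp; omega) Q rfl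
      refine ⟨.app P₁ Q₁, fun N hN => ?_⟩
      rcases appC_inv hN with ⟨_, _, _, _, rfl, -, -, hM, hQ'⟩ |
        ⟨_, _, _, _, _, _, hM, _, h₁, h₂, rfl⟩
      · obtain ⟨_, _, _, rfl, -, -, hM⟩ := absC_inv hM
        exact .betaC hs (hP _ hM) (hQ _ hQ')
      · cases hM
        exact .app (hP _ h₁) (hQ _ h₂)
    · obtain ⟨Ds, hDs⟩ := exists_forall₂_of_forall_mem (Ms := Ms) fun M hM =>
        ih _ (by have := List.sizeOf_lt_of_mem hM; simp; omega) M rfl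
      refine ⟨.const c Ds, fun N hN => ?_⟩
      rcases const_inv hN with ⟨_, rfl, h⟩ | ⟨_, _, h₁, h₂, h₃, _⟩ |
        ⟨_, _, _, _, _, _, _, _, _, _, _, h₁, h₂, h₃, _⟩
      · exact const_of_forall₂ (hDs _ h)
      · exact absurd ⟨_, _, h₁, h₂, h₃⟩ hu
      · exact absurd ⟨_, _, _, _, _, _, _, _, _, h₁, h₂, h₃⟩ hb

/-- Iterated parallel reduction. -/
abbrev Star (Ar : S → S → Prop) (Rr : S → S → S → Prop) :
    Tm (EConst S) → Tm (EConst S) → Prop := Relation.ReflTransGen (Par Ar Rr)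

theorem join_of_eqvGen {A B : Tm (EConst S)} (h : Relation.EqvGen (Par Ar Rr) A B) :
    ∃ D, Star Ar Rr A D ∧ Star Ar Rr B D := by
  have hcr : ∀ a b c, Par Ar Rr a b → Par Ar Rr a c →
      ∃ d, Relation.ReflGen (Par Ar Rr) b d ∧ Relation.ReflTransGen (Par Ar Rr) c d := by
    intro a b c hb hc
    obtain ⟨D, hD⟩ := exists_development (Ar := Ar) (Rr := Rr) a
    exact ⟨D, .single (hD _ hb), .single (hD _ hc)⟩
  induction h with
  | rel _ _ h => exact ⟨_, .single h, .refl⟩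
  | refl _ => exact ⟨_, .refl, .refl⟩
  | symm _ _ _ ih => obtain ⟨D, h₁, h₂⟩ := ih; exact ⟨D, h₂, h₁⟩
  | trans _ _ _ _ _ ih₁ ih₂ =>
    exact (Relation.equivalence_join_reflTransGen hcr).trans ih₁ ih₂

end Par

/-! ## Conversion -/

theorem eqvGen_map {α β : Type*} {r : α → α → Prop} {r' : β → β → Prop} (f : α → β)
    (hf : ∀ a b, r a b → Relation.EqvGen r' (f a) (f b)) {a b : α} (h : Relation.EqvGen r a b) :
    Relation.EqvGen r' (f a) (f b) := by
  induction h with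
  | rel _ _ h => exact hf _ _ h
  | refl _ => exact .refl _
  | symm _ _ _ ih => exact .symm _ _ ih
  | trans _ _ _ _ _ ih₁ ih₂ => exact .trans _ _ _ ih₁ ih₂

theorem Step.par {M N : Tm (EConst S)} (h : Step (rulesEPTS Ar Rr) M N) : Par Ar Rr M N := by
  induction h with
  | base h =>
    rcases h with ⟨A, P, Q, rfl, rfl⟩ | ⟨rl, hrl, σ, rfl, rfl⟩
    · exact .beta (.refl _) (.refl _)
    · rcases hrl with ⟨⟨hs⟩⟩ | ⟨⟨hs⟩⟩
      · simpa [ucon, Ucon, Elcon] using Par.decode hs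
      · simpa [absC, appC] using Par.betaC hs (.refl _) (.refl _)
  | appL _ ih => exact .app ih (.refl _)
  | appR _ ih => exact .app (.refl _) ih
  | lamA _ ih => exact .lam ih (.refl _)
  | lamM _ ih => exact .lam (.refl _) ih
  | piA _ ih => exact .pi ih (.refl _)
  | piB _ ih => exact .pi (.refl _) ih
  | @constArg c l₁ M M' l₂ _ ih =>
    refine Par.const_of_forall₂ (List.rel_append (List.forall₂_same.2 fun _ _ => .refl _) ?_)
    exact .cons ih (List.forall₂_same.2 fun _ _ => .refl _)

namespace Conv

variable {R : Rules C}

theorem refl (M : Tm C) : Conv R M M := Relation.EqvGen.refl _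

theorem symm {M N : Tm C} (h : Conv R M N) : Conv R N M := Relation.EqvGen.symm _ _ h

theorem trans {M N P : Tm C} (h : Conv R M N) (h' : Conv R N P) : Conv R M P :=
  Relation.EqvGen.trans _ _ _ h h'

theorem app {M M' N N' : Tm C} (hM : Conv R M M') (hN : Conv R N N') :
    Conv R (.app M N) (.app M' N') :=
  (eqvGen_map (fun X => Tm.app X N) (fun _ _ h => .rel _ _ (.appL h)) hM).trans _ _ _
    (eqvGen_map (fun X => Tm.app M' X) (fun _ _ h => .rel _ _ (.appR h)) hN)

theorem lam {M M' N N' : Tm C} (hM : Conv R M M') (hN : Conv R N N') :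
    Conv R (.lam M N) (.lam M' N') :=
  (eqvGen_map (fun X => Tm.lam X N) (fun _ _ h => .rel _ _ (.lamA h)) hM).trans _ _ _
    (eqvGen_map (fun X => Tm.lam M' X) (fun _ _ h => .rel _ _ (.lamM h)) hN)

theorem pi {M M' N N' : Tm C} (hM : Conv R M M') (hN : Conv R N N') :
    Conv R (.pi M N) (.pi M' N') :=
  (eqvGen_map (fun X => Tm.pi X N) (fun _ _ h => .rel _ _ (.piA h)) hM).trans _ _ _
    (eqvGen_map (fun X => Tm.pi M' X) (fun _ _ h => .rel _ _ (.piB h)) hN)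

theorem const_append {c : C} {Ms Ns : List (Tm C)} (h : List.Forall₂ (Conv R) Ms Ns)
    (l : List (Tm C)) : Conv R (.const c (l ++ Ms)) (.const c (l ++ Ns)) := by
  induction h generalizing l with
  | nil => exact refl _
  | @cons M N Ms Ns h _ ih =>
    have h₁ := eqvGen_map (r' := Step R) (fun X => Tm.const c (l ++ X :: Ms))
      (fun _ _ h => .rel _ _ (Cong.constArg h)) h
    have h₂ := ih (l ++ [N])
    simp only [List.append_assoc, List.singleton_append] at h₂
    exact trans h₁ h₂

theorem const {c : C} {Ms Ns : List (Tm C)} (h : List.Forall₂ (Conv R) Ms Ns) :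
    Conv R (.const c Ms) (.const c Ns) :=
  const_append h []

theorem beta (A P Q : Tm C) : Conv R (.app (.lam A P) Q) (Tm.substAt 0 Q P) :=
  .rel _ _ (.base (.inl ⟨A, P, Q, rfl, rfl⟩))

theorem of_rule {rl : C × List (Tm C) × Tm C} (h : rl ∈ R) (σ : Nat → Tm C) :
    Conv R (Tm.sub σ (.const rl.1 rl.2.1)) (Tm.sub σ rl.2.2) :=
  .rel _ _ (.base (.inr ⟨rl, h, σ, rfl, rfl⟩))

theorem Elcon_congr {R : Rules (EConst S)} {A A' : Tm (EConst S)} (s : S) (h : Conv R A A') :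
    Conv R (Elcon s A) (Elcon s A') :=
  const (.cons h .nil)

end Conv

theorem Conv.decode {s₁ s₂ : S} (h : Ar s₁ s₂) :
    Conv (rulesEPTS Ar Rr) (Elcon s₂ (ucon s₁)) (Ucon s₁) := by
  simpa [Elcon, ucon, Ucon] using
    Conv.of_rule (R := rulesEPTS Ar Rr) (.inl (URulesMem.u_red h)) Tm.var

theorem Par.conv {M N : Tm (EConst S)} (h : Par Ar Rr M N) : Conv (rulesEPTS Ar Rr) M N := by
  induction h with
  | var => exact .refl _
  | type => exact .refl _
  | kind => exact .refl _
  | const hl _ ih =>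
    exact Conv.const (List.forall₂_iff_zip.2 ⟨hl, fun {a b} hab => ih (a, b) hab⟩)
  | app _ _ h₁ h₂ => exact h₁.app h₂
  | lam _ _ h₁ h₂ => exact h₁.lam h₂
  | pi _ _ h₁ h₂ => exact h₁.pi h₂
  | @beta A P P' Q Q' _ _ h₁ h₂ => exact (((Conv.refl A).lam h₁).app h₂).trans (.beta _ _ _)
  | decode h => exact .decode h
  | @betaC s₁ s₂ s₃ A B A' B' P P' Q Q' h _ _ h₁ h₂ =>
    refine Conv.trans ?_ (h₁.app h₂)
    have := Conv.of_rule (R := rulesEPTS Ar Rr) (.inr (BetaRulesMem.beta h))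
      fun n => [A, B, A', B', P, Q].getD n .type
    simpa [appC, absC] using this

theorem Conv.join {A B : Tm (EConst S)} (h : Conv (rulesEPTS Ar Rr) A B) :
    ∃ D, Par.Star Ar Rr A D ∧ Par.Star Ar Rr B D :=
  Par.join_of_eqvGen (Relation.EqvGen.mono (fun _ _ h => Step.par h) _ _ h)

theorem Par.Star.conv {A B : Tm (EConst S)} (h : Par.Star Ar Rr A B) :
    Conv (rulesEPTS Ar Rr) A B := by
  induction h with
  | refl => exact .refl _
  | tail _ h ih => exact ih.trans h.conv

theorem Conv.sub {M M' : Tm (EConst S)} (h : Conv (rulesEPTS Ar Rr) M M')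
    (σ : Nat → Tm (EConst S)) : Conv (rulesEPTS Ar Rr) (Tm.sub σ M) (Tm.sub σ M') :=
  eqvGen_map (Tm.sub σ) (fun _ _ h => (h.par.sub fun _ => .refl _).conv) h

theorem Conv.ren {M M' : Tm (EConst S)} (h : Conv (rulesEPTS Ar Rr) M M') (ρ : Nat → Nat) :
    Conv (rulesEPTS Ar Rr) (Tm.ren ρ M) (Tm.ren ρ M') := by
  rw [Tm.ren_eq_sub, Tm.ren_eq_sub]
  exact h.sub _

theorem Conv.substAt_zero {M M' N N' : Tm (EConst S)} (hM : Conv (rulesEPTS Ar Rr) M M')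
    (hN : Conv (rulesEPTS Ar Rr) N N') :
    Conv (rulesEPTS Ar Rr) (Tm.substAt 0 N M) (Tm.substAt 0 N' M') := by
  refine Conv.trans (N := Tm.substAt 0 N M') ?_ ?_
  · rw [Tm.substAt_zero, Tm.substAt_zero]
    exact hM.sub _
  · exact eqvGen_map (fun X => Tm.substAt 0 X M')
      (fun _ _ h => ((Par.refl M').substAt_zero h.par).conv) hN

/-! ### Shapes of types -/

theorem Par.Star.pi_inv {A B X : Tm (EConst S)} (h : Par.Star Ar Rr (.pi A B) X) :
    ∃ A' B', X = .pi A' B' ∧ Par.Star Ar Rr A A' ∧ Par.Star Ar Rr B B' := by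
  induction h with
  | refl => exact ⟨_, _, rfl, .refl, .refl⟩
  | tail _ h ih =>
    obtain ⟨A', B', rfl, hA, hB⟩ := ih
    obtain ⟨A'', B'', rfl, hA', hB'⟩ := Par.pi_inv h
    exact ⟨_, _, rfl, hA.tail hA', hB.tail hB'⟩

theorem Par.Star.Ucon_inv {s : S} {X : Tm (EConst S)} (h : Par.Star Ar Rr (Ucon s) X) :
    X = Ucon s := by
  induction h with
  | refl => rfl
  | tail _ h ih => subst ih; exact Par.Ucon_inv h

theorem Par.Star.type_inv {X : Tm (EConst S)} (h : Par.Star Ar Rr .type X) : X = .type := by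
  induction h with
  | refl => rfl
  | tail _ h ih => subst ih; cases h; rfl

theorem Par.Star.kind_inv {X : Tm (EConst S)} (h : Par.Star Ar Rr .kind X) : X = .kind := by
  induction h with
  | refl => rfl
  | tail _ h ih => subst ih; cases h; rfl

theorem Par.Star.Elcon_inv {s : S} {A X : Tm (EConst S)} (h : Par.Star Ar Rr (Elcon s A) X) :
    (∃ A', X = Elcon s A' ∧ Par.Star Ar Rr A A') ∨
    ∃ t, Par.Star Ar Rr A (ucon t) ∧ Ar t s ∧ X = Ucon t := by
  induction h with
  | refl => exact .inl ⟨_, rfl, .refl⟩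
  | tail _ h ih =>
    rcases ih with ⟨A', rfl, hA⟩ | ⟨t, hA, ht, rfl⟩
    · rcases Par.Elcon_inv h with ⟨A'', rfl, hA'⟩ | ⟨t, rfl, ht, rfl⟩
      · exact .inl ⟨_, rfl, hA.tail hA'⟩
      · exact .inr ⟨t, hA, ht, rfl⟩
    · cases Par.Ucon_inv h
      exact .inr ⟨t, hA, ht, rfl⟩

theorem Conv.pi_inj {A B A' B' : Tm (EConst S)}
    (h : Conv (rulesEPTS Ar Rr) (.pi A B) (.pi A' B')) :
    Conv (rulesEPTS Ar Rr) A A' ∧ Conv (rulesEPTS Ar Rr) B B' := by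
  obtain ⟨D, h₁, h₂⟩ := h.join
  obtain ⟨A₁, B₁, rfl, hA, hB⟩ := h₁.pi_inv
  obtain ⟨A₂, B₂, h, hA', hB'⟩ := h₂.pi_inv
  cases h
  exact ⟨hA.conv.trans hA'.conv.symm, hB.conv.trans hB'.conv.symm⟩

theorem Conv.Ucon_inj {s t : S} (h : Conv (rulesEPTS Ar Rr) (Ucon s) (Ucon t)) : s = t := by
  obtain ⟨D, h₁, h₂⟩ := h.join
  cases h₁.Ucon_inv
  cases h₂.Ucon_inv
  rfl

theorem Conv.Elcon_Ucon {s t : S} {A : Tm (EConst S)}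
    (h : Conv (rulesEPTS Ar Rr) (Elcon s A) (Ucon t)) :
    Conv (rulesEPTS Ar Rr) A (ucon t) ∧ Ar t s := by
  obtain ⟨D, h₁, h₂⟩ := h.join
  cases h₂.Ucon_inv
  rcases h₁.Elcon_inv with ⟨_, h, -⟩ | ⟨t, hA, ht, h⟩
  · cases h
  · cases h
    exact ⟨hA.conv, ht⟩

theorem Conv.Elcon_inj {s t : S} {A B : Tm (EConst S)}
    (h : Conv (rulesEPTS Ar Rr) (Elcon s A) (Elcon t B)) : Conv (rulesEPTS Ar Rr) A B := by
  obtain ⟨D, h₁, h₂⟩ := h.join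
  rcases h₁.Elcon_inv with ⟨_, rfl, hA⟩ | ⟨t, hA, ht, rfl⟩
  · rcases h₂.Elcon_inv with ⟨_, h, hB⟩ | ⟨t, hB, ht, h⟩
    · cases h
      exact hA.conv.trans hB.conv.symm
    · cases h
  · rcases h₂.Elcon_inv with ⟨_, h, hB⟩ | ⟨t, hB, ht, h⟩
    · cases h
    · cases h
      exact hA.conv.trans hB.conv.symm

/-- Types of objects: `U_s` or `El_s A`. -/
def IsDecoded (X : Tm (EConst S)) : Prop := (∃ s, X = Ucon s) ∨ ∃ s A, X = Elcon s A

theorem IsDecoded.star {X Y : Tm (EConst S)} (hX : IsDecoded X) (h : Par.Star Ar Rr X Y) :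
    IsDecoded Y := by
  rcases hX with ⟨s, rfl⟩ | ⟨s, A, rfl⟩
  · exact .inl ⟨s, h.Ucon_inv⟩
  · rcases h.Elcon_inv with ⟨A', rfl, -⟩ | ⟨t, -, -, rfl⟩
    · exact .inr ⟨_, _, rfl⟩
    · exact .inl ⟨_, rfl⟩

theorem IsDecoded.not_conv_pi {X A B : Tm (EConst S)} (hX : IsDecoded X) :
    ¬ Conv (rulesEPTS Ar Rr) X (.pi A B) := fun h => by
  obtain ⟨D, h₁, h₂⟩ := h.join
  obtain ⟨_, _, rfl, -, -⟩ := h₂.pi_inv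
  rcases hX.star h₁ with ⟨_, h⟩ | ⟨_, _, h⟩ <;> cases h

theorem IsDKSort.not_conv_pi {X A B : Tm (EConst S)} (hX : IsDKSort X) :
    ¬ Conv (rulesEPTS Ar Rr) X (.pi A B) := fun h => by
  obtain ⟨D, h₁, h₂⟩ := h.join
  obtain ⟨_, _, rfl, -, -⟩ := h₂.pi_inv
  rcases hX with rfl | rfl
  · cases h₁.type_inv
  · cases h₁.kind_inv

theorem IsDecoded.not_conv_sort {X Y : Tm (EConst S)} (hX : IsDecoded X) (hY : IsDKSort Y) :
    ¬ Conv (rulesEPTS Ar Rr) X Y := fun h => by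
  obtain ⟨D, h₁, h₂⟩ := h.join
  have hD := hX.star h₁
  rcases hY with rfl | rfl
  · cases h₂.type_inv
    rcases hD with ⟨_, h⟩ | ⟨_, _, h⟩ <;> cases h
  · cases h₂.kind_inv
    rcases hD with ⟨_, h⟩ | ⟨_, _, h⟩ <;> cases h

/-! ## EPTS conversion -/

theorem ECong.sub {M N : ETm S} (h : EStep Rr M N) (τ : Nat → ETm S) :
    EStep Rr (ETm.sub τ M) (ETm.sub τ N) := by
  induction h generalizing τ with
  | base h =>
    obtain ⟨s₁, s₂, s₃, A, B, A', B', P, Q, hs, rfl, rfl⟩ := h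
    exact .base ⟨s₁, s₂, s₃, _, _, _, _, _, _, hs, rfl, ETm.sub_substAt_zero τ Q P⟩
  | piA _ ih => exact .piA (ih _)
  | piB _ ih => exact .piB (ih _)
  | lamA _ ih => exact .lamA (ih _)
  | lamB _ ih => exact .lamB (ih _)
  | lamM _ ih => exact .lamM (ih _)
  | appA _ ih => exact .appA (ih _)
  | appB _ ih => exact .appB (ih _)
  | appM _ ih => exact .appM (ih _)
  | appN _ ih => exact .appN (ih _)

namespace EConv

theorem refl (M : ETm S) : EConv Rr M M := Relation.EqvGen.refl _

theorem symm {M N : ETm S} (h : EConv Rr M N) : EConv Rr N M := Relation.EqvGen.symm _ _ h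

theorem trans {M N P : ETm S} (h : EConv Rr M N) (h' : EConv Rr N P) : EConv Rr M P :=
  Relation.EqvGen.trans _ _ _ h h'

theorem pi {s₁ s₂ : S} {A A' B B' : ETm S} (hA : EConv Rr A A') (hB : EConv Rr B B') :
    EConv Rr (.pi s₁ s₂ A B) (.pi s₁ s₂ A' B') :=
  (eqvGen_map (fun X => ETm.pi s₁ s₂ X B) (fun _ _ h => .rel _ _ (.piA h)) hA).trans _ _ _
    (eqvGen_map (fun X => ETm.pi s₁ s₂ A' X) (fun _ _ h => .rel _ _ (.piB h)) hB)

theorem lam {s₁ s₂ : S} {A A' B B' M M' : ETm S} (hA : EConv Rr A A') (hB : EConv Rr B B')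
    (hM : EConv Rr M M') : EConv Rr (.lam s₁ s₂ A B M) (.lam s₁ s₂ A' B' M') :=
  ((eqvGen_map (fun X => ETm.lam s₁ s₂ X B M) (fun _ _ h => .rel _ _ (.lamA h)) hA).trans _ _ _
    (eqvGen_map (fun X => ETm.lam s₁ s₂ A' X M) (fun _ _ h => .rel _ _ (.lamB h)) hB)).trans _ _ _
    (eqvGen_map (fun X => ETm.lam s₁ s₂ A' B' X) (fun _ _ h => .rel _ _ (.lamM h)) hM)

theorem app {s₁ s₂ : S} {A A' B B' M M' N N' : ETm S} (hA : EConv Rr A A')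
    (hB : EConv Rr B B') (hM : EConv Rr M M') (hN : EConv Rr N N') :
    EConv Rr (.app s₁ s₂ A B M N) (.app s₁ s₂ A' B' M' N') :=
  (((eqvGen_map (fun X => ETm.app s₁ s₂ X B M N) (fun _ _ h => .rel _ _ (.appA h)) hA).trans _ _ _
    (eqvGen_map (fun X => ETm.app s₁ s₂ A' X M N) (fun _ _ h => .rel _ _ (.appB h)) hB)).trans _ _ _
    (eqvGen_map (fun X => ETm.app s₁ s₂ A' B' X N) (fun _ _ h => .rel _ _ (.appM h)) hM)).trans
    _ _ _ (eqvGen_map (fun X => ETm.app s₁ s₂ A' B' M' X) (fun _ _ h => .rel _ _ (.appN h)) hN)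

theorem sub {M M' : ETm S} (h : EConv Rr M M') (τ : Nat → ETm S) :
    EConv Rr (ETm.sub τ M) (ETm.sub τ M') :=
  eqvGen_map (ETm.sub τ) (fun _ _ h => .rel _ _ (ECong.sub h τ)) h

theorem liftSub {τ τ' : Nat → ETm S} (h : ∀ n, EConv Rr (τ n) (τ' n)) (n : Nat) :
    EConv Rr (ETm.liftSub τ n) (ETm.liftSub τ' n) := by
  cases n with
  | zero => exact refl _
  | succ n =>
    simp only [ETm.liftSub, ETm.ren_eq_sub]
    exact (h n).sub _

theorem sub_pointwise (M : ETm S) {τ τ' : Nat → ETm S} (h : ∀ n, EConv Rr (τ n) (τ' n)) :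
    EConv Rr (ETm.sub τ M) (ETm.sub τ' M) := by
  induction M generalizing τ τ' with
  | var n => exact h n
  | sort s => exact refl _
  | pi s₁ s₂ A B ihA ihB => exact pi (ihA h) (ihB (liftSub h))
  | lam s₁ s₂ A B M ihA ihB ihM => exact lam (ihA h) (ihB (liftSub h)) (ihM (liftSub h))
  | app s₁ s₂ A B M N ihA ihB ihM ihN => exact app (ihA h) (ihB (liftSub h)) (ihM h) (ihN h)

theorem substAt_zero {M M' N N' : ETm S} (hM : EConv Rr M M') (hN : EConv Rr N N') :
    EConv Rr (ETm.substAt 0 N M) (ETm.substAt 0 N' M') := by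
  rw [ETm.substAt_zero, ETm.substAt_zero]
  refine (hM.sub _).trans (sub_pointwise M' fun n => ?_)
  cases n with
  | zero => exact hN
  | succ n => exact refl _

end EConv

/-! ## The inverse translation as a relation -/

/-- `InvRel M E` means that `M` is an invertible form and `|M| = E`. -/
inductive InvRel : Tm (EConst S) → ETm S → Prop
  | var {n} : InvRel (.var n) (.var n)
  | u {s} : InvRel (ucon s) (.sort s)
  | abs {s₁ s₂ A T₁ B T₂ M A' B' M'} : InvRel A A' → InvRel B B' → InvRel M M' →
      InvRel (absC s₁ s₂ A (.lam T₁ B) (.lam T₂ M)) (.lam s₁ s₂ A' B' M')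
  | beta {T M N M' N'} : InvRel M M' → InvRel N N' →
      InvRel (.app (.lam T M) N) (ETm.substAt 0 N' M')
  | prod {s₁ s₂ A T₁ B A' B'} : InvRel A A' → InvRel B B' →
      InvRel (ProdC s₁ s₂ A (.lam T₁ B)) (.pi s₁ s₂ A' B')
  | app {s₁ s₂ A T₁ B M N A' B' M' N'} : InvRel A A' → InvRel B B' → InvRel M M' →
      InvRel N N' → InvRel (appC s₁ s₂ A (.lam T₁ B) M N) (.app s₁ s₂ A' B' M' N')

namespace InvRel

theorem invertible {M : Tm (EConst S)} {E : ETm S} (h : InvRel M E) : Invertible M := by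
  induction h with
  | var => exact .var
  | u => exact .u
  | abs _ _ _ h₁ h₂ h₃ => exact .abs h₁ h₂ h₃
  | beta _ _ h₁ h₂ => exact .beta h₁ h₂
  | prod _ _ h₁ h₂ => exact .prod h₁ h₂
  | app _ _ _ _ h₁ h₂ h₃ h₄ => exact .app h₁ h₂ h₃ h₄

theorem inv_eq {M : Tm (EConst S)} {E : ETm S} (h : InvRel M E) : inv M = some E := by
  induction h <;> simp_all [inv, ucon, absC, ProdC, appC]

theorem trans (E : ETm S) : InvRel (trans E) E := by
  induction E with
  | var n => exact .var
  | sort s => exact .u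
  | pi _ _ _ _ h₁ h₂ => exact .prod h₁ h₂
  | lam _ _ _ _ _ h₁ h₂ h₃ => exact .abs h₁ h₂ h₃
  | app _ _ _ _ _ _ h₁ h₂ h₃ h₄ => exact .app h₁ h₂ h₃ h₄

theorem unique {M : Tm (EConst S)} {E E' : ETm S} (h : InvRel M E) (h' : InvRel M E') :
    E = E' := by
  simpa [h.inv_eq] using h'.inv_eq

theorem ren {M : Tm (EConst S)} {E : ETm S} (h : InvRel M E) (ρ : Nat → Nat) :
    InvRel (Tm.ren ρ M) (ETm.ren ρ E) := by
  induction h generalizing ρ with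
  | var => simpa [ETm.ren] using InvRel.var
  | u => simpa [ucon, ETm.ren] using InvRel.u
  | abs _ _ _ h₁ h₂ h₃ => simpa [absC, ETm.ren] using InvRel.abs (h₁ ρ) (h₂ _) (h₃ _)
  | beta _ _ h₁ h₂ =>
    rw [ETm.ren_substAt_zero]
    simpa using InvRel.beta (h₁ _) (h₂ ρ)
  | prod _ _ h₁ h₂ => simpa [ProdC, ETm.ren] using InvRel.prod (h₁ ρ) (h₂ _)
  | app _ _ _ _ h₁ h₂ h₃ h₄ => simpa [appC, ETm.ren] using InvRel.app (h₁ ρ) (h₂ _) (h₃ ρ) (h₄ ρ)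

theorem liftSub {σ : Nat → Tm (EConst S)} {τ : Nat → ETm S} (h : ∀ n, InvRel (σ n) (τ n))
    (n : Nat) : InvRel (Tm.liftSub σ n) (ETm.liftSub τ n) := by
  cases n with
  | zero => exact .var
  | succ n => exact (h n).ren _

theorem sub {M : Tm (EConst S)} {E : ETm S} (h : InvRel M E) {σ : Nat → Tm (EConst S)}
    {τ : Nat → ETm S} (hσ : ∀ n, InvRel (σ n) (τ n)) : InvRel (Tm.sub σ M) (ETm.sub τ E) := by
  induction h generalizing σ τ with
  | var => simpa [ETm.sub] using hσ _
  | u => simpa [ucon, ETm.sub] using InvRel.u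
  | abs _ _ _ h₁ h₂ h₃ =>
    simpa [absC, ETm.sub] using InvRel.abs (h₁ hσ) (h₂ (liftSub hσ)) (h₃ (liftSub hσ))
  | beta _ _ h₁ h₂ =>
    rw [ETm.sub_substAt_zero]
    simpa using InvRel.beta (h₁ (liftSub hσ)) (h₂ hσ)
  | prod _ _ h₁ h₂ => simpa [ProdC, ETm.sub] using InvRel.prod (h₁ hσ) (h₂ (liftSub hσ))
  | app _ _ _ _ h₁ h₂ h₃ h₄ =>
    simpa [appC, ETm.sub] using InvRel.app (h₁ hσ) (h₂ (liftSub hσ)) (h₃ hσ) (h₄ hσ)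

theorem substAt_zero {M N : Tm (EConst S)} {E F : ETm S} (hM : InvRel M E) (hN : InvRel N F) :
    InvRel (Tm.substAt 0 N M) (ETm.substAt 0 F E) := by
  rw [Tm.substAt_zero, ETm.substAt_zero]
  refine hM.sub fun n => ?_
  cases n with
  | zero => exact hN
  | succ n => exact .var

/-- Invertible forms are closed under reduction, and `|·|` maps reduction to conversion. -/
theorem par {M N : Tm (EConst S)} {E : ETm S} (h : InvRel M E) (hMN : Par Ar Rr M N) :
    ∃ F, InvRel N F ∧ EConv Rr E F := by
  induction hn : sizeOf M using Nat.strong_induction_on generalizing M N E with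
  | _ n ih =>
  subst hn
  cases h with
  | var => cases hMN; exact ⟨_, .var, .refl _⟩
  | u => cases hMN.ucon_inv; exact ⟨_, .u, .refl _⟩
  | abs hA hB hM =>
    obtain ⟨_, _, _, rfl, h₁, h₂, h₃⟩ := hMN.absC_inv
    obtain ⟨_, _, rfl, -, h₂⟩ := h₂.lam_inv
    obtain ⟨_, _, rfl, -, h₃⟩ := h₃.lam_inv
    obtain ⟨_, hA', eA⟩ := ih _ (by simp [absC]; omega) hA h₁ rfl
    obtain ⟨_, hB', eB⟩ := ih _ (by simp [absC]; omega) hB h₂ rfl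
    obtain ⟨_, hM', eM⟩ := ih _ (by simp [absC]; omega) hM h₃ rfl
    exact ⟨_, .abs hA' hB' hM', eA.lam eB eM⟩
  | beta hM hN =>
    rcases hMN.app_inv with ⟨_, _, rfl, h₁, h₂⟩ | ⟨_, _, _, _, h, h₁, h₂, rfl⟩
    · obtain ⟨_, _, rfl, -, h₁⟩ := h₁.lam_inv
      obtain ⟨_, hM', eM⟩ := ih _ (by simp; omega) hM h₁ rfl
      obtain ⟨_, hN', eN⟩ := ih _ (by simp) hN h₂ rfl
      exact ⟨_, .beta hM' hN', eM.substAt_zero eN⟩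
    · cases h
      obtain ⟨_, hM', eM⟩ := ih _ (by simp; omega) hM h₁ rfl
      obtain ⟨_, hN', eN⟩ := ih _ (by simp) hN h₂ rfl
      exact ⟨_, hM'.substAt_zero hN', eM.substAt_zero eN⟩
  | prod hA hB =>
    obtain ⟨_, _, rfl, h₁, h₂⟩ := hMN.ProdC_inv
    obtain ⟨_, _, rfl, -, h₂⟩ := h₂.lam_inv
    obtain ⟨_, hA', eA⟩ := ih _ (by simp [ProdC]; omega) hA h₁ rfl
    obtain ⟨_, hB', eB⟩ := ih _ (by simp [ProdC]; omega) hB h₂ rfl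
    exact ⟨_, .prod hA' hB', eA.pi eB⟩
  | app hA hB hM hN =>
    rcases hMN.appC_inv with ⟨_, _, _, _, rfl, h₁, h₂, h₃, h₄⟩ |
      ⟨_, _, _, _, _, _, h, hs, hP, hQ, rfl⟩
    · obtain ⟨_, _, rfl, -, h₂⟩ := h₂.lam_inv
      obtain ⟨_, hA', eA⟩ := ih _ (by simp [appC]; omega) hA h₁ rfl
      obtain ⟨_, hB', eB⟩ := ih _ (by simp [appC]; omega) hB h₂ rfl
      obtain ⟨_, hM', eM⟩ := ih _ (by simp [appC]; omega) hM h₃ rfl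
      obtain ⟨_, hN', eN⟩ := ih _ (by simp [appC]; omega) hN h₄ rfl
      exact ⟨_, .app hA' hB' hM' hN', eA.app eB eM eN⟩
    · subst h
      generalize hX : absC _ _ _ _ _ = X at hM
      cases hM with
      | abs hA₂ hB₂ hM₂ =>
        cases hX
        obtain ⟨_, _, rfl, -, hP⟩ := hP.lam_inv
        obtain ⟨_, hM', eM⟩ := ih _ (by simp [appC, absC]; omega) hM₂ hP rfl
        obtain ⟨_, hN', eN⟩ := ih _ (by simp [appC]; omega) hN hQ rfl
        refine ⟨_, .beta hM' hN', EConv.trans ?_ (eM.substAt_zero eN)⟩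
        exact .rel _ _ (.base ⟨_, _, _, _, _, _, _, _, _, hs, rfl, rfl⟩)
      | _ => cases hX

theorem star {M N : Tm (EConst S)} {E : ETm S} (h : InvRel M E) (hMN : Par.Star Ar Rr M N) :
    ∃ F, InvRel N F ∧ EConv Rr E F := by
  induction hMN with
  | refl => exact ⟨E, h, .refl _⟩
  | tail _ hs ih =>
    obtain ⟨F, hF, e⟩ := ih
    obtain ⟨G, hG, e'⟩ := hF.par hs
    exact ⟨G, hG, e.trans e'⟩

/-- `|·|` maps conversion to conversion. -/
theorem econv {M N : Tm (EConst S)} {E F : ETm S} (hM : InvRel M E) (hN : InvRel N F)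
    (h : Conv (rulesEPTS Ar Rr) M N) : EConv Rr E F := by
  obtain ⟨D, h₁, h₂⟩ := h.join
  obtain ⟨G, hG, e⟩ := hM.star h₁
  obtain ⟨G', hG', e'⟩ := hN.star h₂
  cases hG.unique hG'
  exact e.trans e'.symm

end InvRel

/-! ## Hidden conversion -/

theorem Cong.mono {r r' : Tm C → Tm C → Prop} (h : ∀ M N, r M N → Cong r' M N) {M N : Tm C}
    (hMN : Cong r M N) : Cong r' M N := by
  induction hMN with
  | base h' => exact h _ _ h'
  | appL _ ih => exact .appL ih
  | appR _ ih => exact .appR ih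
  | lamA _ ih => exact .lamA ih
  | lamM _ ih => exact .lamM ih
  | piA _ ih => exact .piA ih
  | piB _ ih => exact .piB ih
  | constArg _ ih => exact .constArg ih

namespace HConv

variable {R : Rules (EConst S)}

theorem conv {M N : Tm (EConst S)} (h : HConv R M N) : Conv R M N := by
  refine Relation.EqvGen.mono (fun _ _ h => Cong.mono ?_ h) _ _ h
  rintro _ _ ⟨A, A', P, h, rfl, rfl⟩
  exact .lamA h

theorem lam {A A' M M' : Tm (EConst S)} (hA : Conv R A A') (hM : HConv R M M') :
    HConv R (.lam A M) (.lam A' M') :=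
  (eqvGen_map (fun X => Tm.lam X M)
    (fun _ _ h => .rel _ _ (.base ⟨_, _, _, h, rfl, rfl⟩)) hA).trans _ _ _
    (eqvGen_map (fun X => Tm.lam A' X) (fun _ _ h => .rel _ _ (.lamM h)) hM)

theorem const_append {c : EConst S} {Ms Ns : List (Tm (EConst S))}
    (h : List.Forall₂ (HConv R) Ms Ns) (l : List (Tm (EConst S))) :
    HConv R (.const c (l ++ Ms)) (.const c (l ++ Ns)) := by
  induction h generalizing l with
  | nil => exact .refl _
  | @cons M N Ms Ns h _ ih =>
    have h₁ := eqvGen_map (r' := HStep R) (fun X => Tm.const c (l ++ X :: Ms))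
      (fun _ _ h => .rel _ _ (Cong.constArg h)) h
    have h₂ := ih (l ++ [N])
    simp only [List.append_assoc, List.singleton_append] at h₂
    exact .trans _ _ _ h₁ h₂

theorem const {c : EConst S} {Ms Ns : List (Tm (EConst S))}
    (h : List.Forall₂ (HConv R) Ms Ns) : HConv R (.const c Ms) (.const c Ns) :=
  const_append h []

end HConv

/-! ## Generation for Dedukti typing -/

/-- What the typability of `M` with type `T` says about the immediate subterms of `M`. -/
def Generation (Sg : Sig C) (R : Rules C) (Γ : List (Tm C)) : Tm C → Tm C → Prop
  | .var n, T => ∃ A, Γ[n]? = some A ∧ Conv R T (Tm.ren (· + (n + 1)) A)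
  | .const c Ms, T => ∃ Δ A, (c, Δ, A) ∈ Sg ∧ TypedArgs Sg R Γ Ms Δ ∧ Conv R T (instArgs Ms A)
  | .type, T => Conv R T .kind
  | .kind, _ => False
  | .app M N, T => ∃ A B, Typed Sg R Γ M (.pi A B) ∧ Typed Sg R Γ N A ∧
      Conv R T (Tm.substAt 0 N B)
  | .lam A M, T => ∃ B, Typed Sg R (A :: Γ) M B ∧ Conv R T (.pi A B)
  | .pi _ _, T => ∃ s, IsDKSort s ∧ Conv R T s

theorem Generation.conv {Sg : Sig C} {R : Rules C} {Γ : List (Tm C)} {M T T' : Tm C}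
    (h : Generation Sg R Γ M T) (hT : Conv R T T') : Generation Sg R Γ M T' := by
  cases M with
  | var n => exact let ⟨A, h, hc⟩ := h; ⟨A, h, hT.symm.trans hc⟩
  | const c Ms => exact let ⟨Δ, A, h, h', hc⟩ := h; ⟨Δ, A, h, h', hT.symm.trans hc⟩
  | type => exact hT.symm.trans h
  | kind => exact h
  | app M N => exact let ⟨A, B, h, h', hc⟩ := h; ⟨A, B, h, h', hT.symm.trans hc⟩
  | lam A M => exact let ⟨B, h, hc⟩ := h; ⟨B, h, hT.symm.trans hc⟩
  | pi A B => exact let ⟨s, h, hc⟩ := h; ⟨s, h, hT.symm.trans hc⟩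

theorem Typed.generation {Sg : Sig C} {R : Rules C} {Γ : List (Tm C)} {M T : Tm C}
    (h : Typed Sg R Γ M T) : Generation Sg R Γ M T :=
  match h with
  | .sort _ => .refl _
  | .var _ h => ⟨_, h, .refl _⟩
  | .cons h _ _ h' => ⟨_, _, h, h', .refl _⟩
  | .conv h _ _ hc => (generation h).conv hc
  | .prod _ _ hs => ⟨_, hs, .refl _⟩
  | .abs _ _ _ h => ⟨_, h, .refl _⟩
  | .app h h' => ⟨_, _, h, h', .refl _⟩

theorem TypedArgs.cons_inv {Sg : Sig C} {R : Rules C} {Γ Ms Δ : List (Tm C)} {A : Tm C}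
    (h : TypedArgs Sg R Γ Ms (A :: Δ)) :
    ∃ M Ns, Ms = M :: Ns ∧ Typed Sg R Γ M A ∧ TypedArgs Sg R Γ Ns (instTele M Δ) := by
  cases h with
  | cons h h' => exact ⟨_, _, rfl, h, h'⟩

theorem TypedArgs.nil_inv {Sg : Sig C} {R : Rules C} {Γ Ms : List (Tm C)}
    (h : TypedArgs Sg R Γ Ms []) : Ms = [] := by
  cases h; rfl

/-! ## β-normal forms -/

theorem BetaNormal.of_mem_const {c : C} {Ms : List (Tm C)} (h : BetaNormal (.const c Ms))
    {M : Tm C} (hM : M ∈ Ms) : BetaNormal M := fun N hN => by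
  obtain ⟨l₁, l₂, rfl⟩ := List.append_of_mem hM
  exact h _ (.constArg hN)

theorem BetaNormal.of_app_left {M N : Tm C} (h : BetaNormal (.app M N)) : BetaNormal M :=
  fun _ hN => h _ (.appL hN)

theorem BetaNormal.of_lam_body {A M : Tm C} (h : BetaNormal (.lam A M)) : BetaNormal M :=
  fun _ hN => h _ (.lamM hN)

theorem BetaNormal.app_ne_lam {M N : Tm C} (h : BetaNormal (.app M N)) (A P : Tm C) :
    M ≠ .lam A P := by
  rintro rfl
  exact h _ (.base ⟨A, P, N, rfl, rfl⟩)

/-! ## Reflecting typing derivations -/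

theorem Tm.substAt_var_self (k : Nat) (N : Tm C) : substAt k N (var k) = ren (· + k) N := by
  simp [substAt]

theorem Tm.substAt_var_of_lt {k n : Nat} (h : n < k) (N : Tm C) :
    substAt k N (var n) = var n := by
  simp [substAt, h]

theorem Tm.substAt_const (k : Nat) (N : Tm C) (c : C) (Ms : List (Tm C)) :
    substAt k N (const c Ms) = const c (Ms.map (substAt k N)) := by
  simp [substAt]

theorem Tm.substAt_app (k : Nat) (N P Q : Tm C) :
    substAt k N (app P Q) = app (substAt k N P) (substAt k N Q) := by
  simp [substAt]

theorem Tm.substAt_pi (k : Nat) (N A B : Tm C) :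
    substAt k N (pi A B) = pi (substAt k N A) (substAt (k + 1) N B) := by
  rw [substAt, sub_pi, substAt]
  congr 2
  funext n
  cases n with
  | zero => simp [liftSub]
  | succ n =>
    rcases lt_trichotomy n k with h | rfl | h
    · simp [liftSub, h]
    · simp only [liftSub, lt_irrefl, if_true, if_false, ren_ren]
      rfl
    · have h₁ : ¬ n < k := by omega
      have h₂ : n ≠ k := by omega
      simp only [liftSub, h₁, h₂, if_false, ren_var, Nat.add_lt_add_iff_right,
        Nat.add_right_cancel_iff]
      congr 1
      omega

theorem Tm.substAt_ren (k : Nat) (N M : Tm C) :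
    substAt k N (ren (· + (k + 1)) M) = ren (· + k) M := by
  rw [substAt, sub_ren, ren_eq_sub (· + k) M]
  congr 1
  funext n
  have h₁ : ¬ n + (k + 1) < k := by omega
  have h₂ : n + (k + 1) ≠ k := by omega
  simp only [Function.comp, if_neg h₁, if_neg h₂]
  congr 1

theorem Tm.substAt_zero_ren (N M : Tm C) : substAt 0 N (ren (· + 1) M) = M :=
  (substAt_ren 0 N M).trans (ren_id M)

theorem Tm.substAt_one_ren (N M : Tm C) : substAt 1 N (ren (· + 2) M) = ren (· + 1) M :=
  substAt_ren 1 N M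

theorem Tm.substAt_zero_var_ren_liftRen (M : Tm C) :
    substAt 0 (var 0) (ren (liftRen (· + 1)) M) = M := by
  rw [substAt_zero, sub_ren]
  refine Eq.trans (congrArg (sub · M) ?_) (sub_var_eq_self M)
  funext n
  cases n <;> rfl

/-- `Δ` is the translation of the well-formed context `Γ`, up to conversion. -/
def CtxRel (Ar : S → S → Prop) (Rr : S → S → S → Prop) (Γ : List (ETm S))
    (Δ : List (Tm (EConst S))) : Prop :=
  EWf Ar Rr Γ ∧
    List.Forall₂ (fun A D => ∃ s, Conv (rulesEPTS Ar Rr) D (Elcon s (trans A))) Γ Δ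

/-- `T` is the decoding of the translation of the type `A`, up to conversion. -/
def TypeRel (Ar : S → S → Prop) (Rr : S → S → S → Prop) (Γ : List (ETm S)) (A : ETm S)
    (T : Tm (EConst S)) : Prop :=
  (∃ s, A = .sort s ∧ Conv (rulesEPTS Ar Rr) T (Ucon s)) ∨
    ∃ s, ETyped Ar Rr Γ A (.sort s) ∧ Conv (rulesEPTS Ar Rr) T (Elcon s (trans A))

theorem CtxRel.cons {Γ : List (ETm S)} {Δ : List (Tm (EConst S))} (h : CtxRel Ar Rr Γ Δ)
    {A : ETm S} {D : Tm (EConst S)} {s : S} (hA : ETyped Ar Rr Γ A (.sort s))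
    (hD : Conv (rulesEPTS Ar Rr) D (Elcon s (trans A))) : CtxRel Ar Rr (A :: Γ) (D :: Δ) :=
  ⟨.decl hA, .cons ⟨s, hD⟩ h.2⟩

theorem CtxRel.getElem? {Γ : List (ETm S)} {Δ : List (Tm (EConst S))} (h : CtxRel Ar Rr Γ Δ)
    {n : Nat} {D : Tm (EConst S)} (hD : Δ[n]? = some D) :
    ∃ A s, Γ[n]? = some A ∧ Conv (rulesEPTS Ar Rr) D (Elcon s (trans A)) := by
  obtain ⟨-, h⟩ := h
  induction h generalizing n with
  | nil => simp at hD
  | @cons A _ _ _ h _ ih =>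
    cases n with
    | zero =>
      obtain ⟨s, hs⟩ := h
      simp only [List.getElem?_cons_zero, Option.some.injEq] at hD
      subst hD
      exact ⟨A, s, by simp, hs⟩
    | succ n => simpa using ih (by simpa using hD)

theorem CtxRel.of_transCtx {Γ : List (ETm S)} {Δ : List (Tm (EConst S))}
    (h : TransCtx Ar Rr Γ Δ) : CtxRel Ar Rr Γ Δ := by
  induction h with
  | nil => exact ⟨.empty, .nil⟩
  | cons _ hA ih => exact ih.cons hA (.refl _)

theorem TypeRel.isDecoded {Γ : List (ETm S)} {A : ETm S} {T : Tm (EConst S)}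
    (h : TypeRel Ar Rr Γ A T) : ∃ X, IsDecoded X ∧ Conv (rulesEPTS Ar Rr) T X := by
  rcases h with ⟨s, -, h⟩ | ⟨s, -, h⟩
  · exact ⟨_, .inl ⟨s, rfl⟩, h⟩
  · exact ⟨_, .inr ⟨s, _, rfl⟩, h⟩

theorem TypeRel.etyped_of_Elcon {Γ : List (ETm S)} {A B E : ETm S} {T : Tm (EConst S)} {s : S}
    (hA : TypeRel Ar Rr Γ A T) (hΓ : EWf Ar Rr Γ) (hE : ETyped Ar Rr Γ E B)
    (hT : Conv (rulesEPTS Ar Rr) T (Elcon s (trans B))) : ETyped Ar Rr Γ E A := by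
  rcases hA with ⟨t, rfl, h⟩ | ⟨t, hA, h⟩
  · obtain ⟨hB, ht⟩ := (hT.symm.trans h).Elcon_Ucon
    exact .conv hE (.sort hΓ ht) ((InvRel.trans B).econv .u hB)
  · exact .conv hE hA ((InvRel.trans B).econv (.trans A) (hT.symm.trans h).Elcon_inj)

theorem TypeRel.etyped_of_Ucon {Γ : List (ETm S)} {A E : ETm S} {T : Tm (EConst S)} {s : S}
    (hA : TypeRel Ar Rr Γ A T) (hE : ETyped Ar Rr Γ E (.sort s))
    (hT : Conv (rulesEPTS Ar Rr) T (Ucon s)) : ETyped Ar Rr Γ E A := by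
  rcases hA with ⟨t, rfl, h⟩ | ⟨t, hA, h⟩
  · cases (hT.symm.trans h).Ucon_inj
    exact hE
  · have h' := (h.symm.trans hT).Elcon_Ucon.1
    exact .conv hE hA (InvRel.econv .u (.trans A) h'.symm)

/-- In the context of a translated context, a β-normal term of product type is a λ-abstraction. -/
theorem exists_lam_of_typed_pi {Γ : List (ETm S)} {Δ : List (Tm (EConst S))}
    (hΓ : CtxRel Ar Rr Γ Δ) {M T A B : Tm (EConst S)} (hnf : BetaNormal M)
    (h : Typed (sigEPTS Ar Rr) (rulesEPTS Ar Rr) Δ M T)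
    (hT : Conv (rulesEPTS Ar Rr) T (.pi A B)) :
    ∃ A' P B', M = .lam A' P ∧ Conv (rulesEPTS Ar Rr) A' A ∧ Conv (rulesEPTS Ar Rr) B' B ∧
      Typed (sigEPTS Ar Rr) (rulesEPTS Ar Rr) (A' :: Δ) P B' := by
  induction M using Tm.structural_induction generalizing T A B with
  | var n =>
    obtain ⟨D, hD, hc⟩ := h.generation
    obtain ⟨E, s, -, hE⟩ := hΓ.getElem? hD
    refine absurd ((hE.ren _).symm.trans (hc.symm.trans hT)) (IsDecoded.not_conv_pi ?_)
    exact .inr ⟨s, Tm.ren (· + (n + 1)) (trans E), by simp [Elcon]⟩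
  | const c Ms =>
    obtain ⟨Δ', X, hX, -, hc⟩ := h.generation
    have hc := hc.symm.trans hT
    rcases hX with _ | _ | _ | _ | _ | _
    · exact absurd hc (IsDKSort.not_conv_pi (.inl (by simp [instArgs])))
    · exact absurd hc (IsDKSort.not_conv_pi (.inl (by simp [instArgs])))
    all_goals
      refine absurd hc (IsDecoded.not_conv_pi ?_)
      simp [instArgs, IsDecoded, Ucon, Elcon]
  | type => exact absurd (h.generation.symm.trans hT) (IsDKSort.not_conv_pi (.inr rfl))
  | kind => exact h.generation.elim
  | app M N ihM ihN =>
    obtain ⟨A₁, B₁, hM, -⟩ := h.generation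
    obtain ⟨A', P, _, hl, -⟩ := ihM hnf.of_app_left hM (.refl _)
    exact absurd hl (hnf.app_ne_lam A' P)
  | lam A' P =>
    obtain ⟨B', hP, hc⟩ := h.generation
    obtain ⟨hA, hB⟩ := (hc.symm.trans hT).pi_inj
    exact ⟨A', P, B', rfl, hA, hB, hP⟩
  | pi A' B' =>
    obtain ⟨s, hs, hc⟩ := h.generation
    exact absurd (hc.symm.trans hT) hs.not_conv_pi

theorem exists_invRel_of_typed {Γ : List (ETm S)} {Δ : List (Tm (EConst S))}
    (hΓ : CtxRel Ar Rr Γ Δ) {A : ETm S} {M T : Tm (EConst S)} (hA : TypeRel Ar Rr Γ A T)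
    (hnf : BetaNormal M) (h : Typed (sigEPTS Ar Rr) (rulesEPTS Ar Rr) Δ M T) :
    ∃ E, InvRel M E ∧ ETyped Ar Rr Γ E A ∧ HConv (rulesEPTS Ar Rr) (trans E) M := by
  induction hn : sizeOf M using Nat.strong_induction_on generalizing Γ Δ A M T with
  | _ n ih =>
  subst hn
  obtain ⟨X, hX, hTX⟩ := hA.isDecoded
  cases M with
  | var n =>
    obtain ⟨D, hD, hc⟩ := h.generation
    obtain ⟨B, s, hB, hs⟩ := hΓ.getElem? hD
    refine ⟨.var n, .var, hA.etyped_of_Elcon (s := s) hΓ.1 (.var hΓ.1 hB) (hc.trans ?_), .refl _⟩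
    rw [trans_ren]
    simpa [Elcon] using hs.ren (· + (n + 1))
  | type => exact absurd (hTX.symm.trans h.generation) (hX.not_conv_sort (.inr rfl))
  | kind => exact h.generation.elim
  | app M N =>
    obtain ⟨A₁, B₁, hM, -⟩ := h.generation
    obtain ⟨A', P, _, hl, -⟩ := exists_lam_of_typed_pi hΓ hnf.of_app_left hM (.refl _)
    exact absurd hl (hnf.app_ne_lam A' P)
  | lam A' P =>
    obtain ⟨B', -, hc⟩ := h.generation
    exact absurd (hTX.symm.trans hc) hX.not_conv_pi
  | pi A' B' =>
    obtain ⟨s, hs, hc⟩ := h.generation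
    exact absurd (hTX.symm.trans hc) (hX.not_conv_sort hs)
  | const c Ms =>
    obtain ⟨Δ', Y, hY, hMs, hc⟩ := h.generation
    -- The first two arguments of `Prod`, `abs` and `app` are a type and a family over it.
    have family : ∀ {s₁ s₂ : S} {P Q : Tm (EConst S)}, P ∈ Ms → Q ∈ Ms →
        Typed (sigEPTS Ar Rr) (rulesEPTS Ar Rr) Δ P (Ucon s₁) →
        Typed (sigEPTS Ar Rr) (rulesEPTS Ar Rr) Δ Q
          (Tm.substAt 0 P (.pi (Elcon s₁ (.var 0)) (Ucon s₂))) →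
        ∃ E F T₁ Q₁, Q = .lam T₁ Q₁ ∧ InvRel P E ∧ InvRel Q₁ F ∧
          ETyped Ar Rr Γ E (.sort s₁) ∧ ETyped Ar Rr (E :: Γ) F (.sort s₂) ∧
          HConv (rulesEPTS Ar Rr) (trans E) P ∧ HConv (rulesEPTS Ar Rr) (trans F) Q₁ ∧
          Conv (rulesEPTS Ar Rr) (Elcon s₁ (trans E)) T₁ := by
      intro s₁ s₂ P Q hPm hQm hP hQ
      have sP := List.sizeOf_lt_of_mem hPm
      have sQ := List.sizeOf_lt_of_mem hQm
      obtain ⟨E, iE, tE, cE⟩ := ih _ (by simp; omega) hΓ (.inl ⟨s₁, rfl, .refl _⟩)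
        (hnf.of_mem_const hPm) hP rfl
      have hpi : Tm.substAt 0 P (.pi (Elcon s₁ (.var 0)) (Ucon s₂)) =
          .pi (Elcon s₁ P) (Ucon s₂) := by
        simp [Tm.substAt_zero, Elcon, Ucon, Tm.inst]
      rw [hpi] at hQ
      obtain ⟨T₁, Q₁, B', rfl, hT₁, hB', hQ₁⟩ :=
        exists_lam_of_typed_pi hΓ (hnf.of_mem_const hQm) hQ (.refl _)
      have hT₁ := hT₁.trans (cE.conv.symm.Elcon_congr s₁)
      simp only [Tm.lam.sizeOf_spec] at sQ
      obtain ⟨F, iF, tF, cF⟩ := ih _ (by simp; omega) (hΓ.cons tE hT₁)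
        (.inl ⟨s₂, rfl, hB'⟩) (hnf.of_mem_const hQm).of_lam_body hQ₁ rfl
      exact ⟨E, F, T₁, Q₁, rfl, iE, iF, tE, tF, cE, cF, hT₁.symm⟩
    rcases hY with s | s | hs | @⟨s₁, s₂, s₃, hs⟩ | @⟨s₁, s₂, s₃, hs⟩ | @⟨s₁, s₂, s₃, hs⟩
    · exact absurd (hTX.symm.trans hc) (hX.not_conv_sort (.inl (by simp [instArgs])))
    · exact absurd (hTX.symm.trans hc) (hX.not_conv_sort (.inl (by simp [instArgs])))
    · cases hMs.nil_inv
      refine ⟨_, .u, hA.etyped_of_Ucon (.sort hΓ.1 hs) ?_, .refl _⟩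
      simpa [instArgs, Ucon] using hc
    · obtain ⟨P, _, rfl, hP, hMs⟩ := hMs.cons_inv
      obtain ⟨Q, _, rfl, hQ, hMs⟩ := hMs.cons_inv
      cases hMs.nil_inv
      obtain ⟨E, F, T₁, Q₁, rfl, iE, iF, tE, tF, cE, cF, cT₁⟩ :=
        family (by simp) (by simp) hP hQ
      refine ⟨_, .prod iE iF, hA.etyped_of_Ucon (.pi hs tE tF) ?_,
        HConv.const (.cons cE (.cons (cF.lam cT₁) .nil))⟩
      simpa [instArgs, Ucon] using hc
    · obtain ⟨P, _, rfl, hP, hMs⟩ := hMs.cons_inv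
      obtain ⟨Q, _, rfl, hQ, hMs⟩ := hMs.cons_inv
      obtain ⟨M, _, rfl, hM, hMs⟩ := hMs.cons_inv
      cases hMs.nil_inv
      obtain ⟨E, F, T₁, Q₁, rfl, iE, iF, tE, tF, cE, cF, cT₁⟩ :=
        family (by simp) (by simp) hP hQ
      have hpi : Tm.substAt 0 (.lam T₁ Q₁) (Tm.substAt 1 P
          (.pi (Elcon s₁ (.var 1)) (Elcon s₂ (.app (.var 1) (.var 0))))) =
          .pi (Elcon s₁ P) (Elcon s₂ (.app (Tm.ren (· + 1) (.lam T₁ Q₁)) (.var 0))) := by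
        simp [Elcon, Tm.substAt_pi, Tm.substAt_const, Tm.substAt_app, Tm.substAt_var_self,
          Tm.substAt_var_of_lt, Tm.substAt_zero_ren]
      have hM : Typed _ _ _ _ (Tm.substAt 0 (.lam T₁ Q₁) (Tm.substAt 1 P
          (.pi (Elcon s₁ (.var 1)) (Elcon s₂ (.app (.var 1) (.var 0)))))) := hM
      rw [hpi] at hM
      obtain ⟨T₂, M₁, B', rfl, hT₂, hB', hM₁⟩ :=
        exists_lam_of_typed_pi hΓ (hnf.of_mem_const (by simp)) hM (.refl _)
      have hT₂ := hT₂.trans (cE.conv.symm.Elcon_congr s₁)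
      have hβ : Conv (rulesEPTS Ar Rr) (.app (Tm.ren (· + 1) (.lam T₁ Q₁)) (.var 0)) Q₁ := by
        have h := Conv.beta (R := rulesEPTS Ar Rr) (Tm.ren (· + 1) T₁)
          (Tm.ren (Tm.liftRen (· + 1)) Q₁) (.var 0)
        rw [Tm.substAt_zero_var_ren_liftRen] at h
        rwa [Tm.ren_lam]
      have hB' := hB'.trans ((hβ.trans cF.conv.symm).Elcon_congr s₂)
      obtain ⟨G, iG, tG, cG⟩ := ih _ (by simp; omega) (hΓ.cons tE hT₂)
        (.inr ⟨s₂, tF, hB'⟩) (hnf.of_mem_const (M := .lam T₂ M₁) (by simp)).of_lam_body hM₁ rfl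
      refine ⟨_, .abs iE iF iG, hA.etyped_of_Elcon (s := s₃) hΓ.1 (.lam hs tE tF tG) ?_,
        HConv.const (.cons cE (.cons (cF.lam cT₁) (.cons (cG.lam hT₂.symm) .nil)))⟩
      have hc : Conv (rulesEPTS Ar Rr) T (Elcon s₃ (ProdC s₁ s₂ P (.lam T₁ Q₁))) := by
        simpa [instArgs, Elcon, ProdC] using hc
      exact hc.trans (.Elcon_congr s₃
        (.const (.cons cE.conv.symm (.cons (cF.lam cT₁).conv.symm .nil))))
    · obtain ⟨P, _, rfl, hP, hMs⟩ := hMs.cons_inv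
      obtain ⟨Q, _, rfl, hQ, hMs⟩ := hMs.cons_inv
      obtain ⟨M, _, rfl, hM, hMs⟩ := hMs.cons_inv
      obtain ⟨N, _, rfl, hN, hMs⟩ := hMs.cons_inv
      cases hMs.nil_inv
      obtain ⟨E, F, T₁, Q₁, rfl, iE, iF, tE, tF, cE, cF, cT₁⟩ :=
        family (by simp) (by simp) hP hQ
      have hid : Tm.ren (fun n => n) (.lam T₁ Q₁) = .lam T₁ Q₁ := Tm.ren_id _
      have hProd : Tm.substAt 0 (.lam T₁ Q₁) (Tm.substAt 1 P
          (Elcon s₃ (ProdC s₁ s₂ (.var 1) (.var 0)))) =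
          Elcon s₃ (ProdC s₁ s₂ P (.lam T₁ Q₁)) := by
        simp [Elcon, ProdC, Tm.substAt_const, Tm.substAt_var_self, Tm.substAt_var_of_lt,
          Tm.substAt_zero_ren, hid, -Tm.ren_lam]
      have hM : Typed _ _ _ _ (Tm.substAt 0 (.lam T₁ Q₁) (Tm.substAt 1 P
          (Elcon s₃ (ProdC s₁ s₂ (.var 1) (.var 0))))) := hM
      rw [hProd] at hM
      have hDom : Tm.substAt 0 M (Tm.substAt 1 (.lam T₁ Q₁) (Tm.substAt 2 P
          (Elcon s₁ (.var 2)))) = Elcon s₁ P := by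
        simp [Elcon, Tm.substAt_const, Tm.substAt_var_self, Tm.substAt_one_ren,
          Tm.substAt_zero_ren]
      have hN : Typed _ _ _ _ (Tm.substAt 0 M (Tm.substAt 1 (.lam T₁ Q₁) (Tm.substAt 2 P
          (Elcon s₁ (.var 2))))) := hN
      rw [hDom] at hN
      obtain ⟨M₀, iM, tM, cM⟩ := ih _ (by simp; omega) hΓ (A := .pi s₁ s₂ E F)
        (.inr ⟨s₃, .pi hs tE tF, .Elcon_congr s₃
          (.const (.cons cE.conv.symm (.cons (cF.lam cT₁).conv.symm .nil)))⟩)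
        (hnf.of_mem_const (by simp)) hM rfl
      obtain ⟨N₀, iN, tN, cN⟩ := ih _ (by simp; omega) hΓ
        (.inr ⟨s₁, tE, cE.conv.symm.Elcon_congr s₁⟩) (hnf.of_mem_const (by simp)) hN rfl
      refine ⟨_, .app iE iF iM iN, hA.etyped_of_Elcon (s := s₂) hΓ.1 (.app hs tE tF tN tM) ?_,
        HConv.const (.cons cE (.cons (cF.lam cT₁) (.cons cM (.cons cN .nil))))⟩
      have hc : Conv (rulesEPTS Ar Rr) T (Elcon s₂ (.app (.lam T₁ Q₁) N)) := by
        simpa [instArgs, Elcon] using hc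
      rw [trans_substAt_zero]
      exact hc.trans (((Conv.beta T₁ Q₁ N).trans
        (cF.conv.symm.substAt_zero cN.conv.symm)).Elcon_congr s₂)

/-- Conservativity for β-normal forms. -/
theorem conservativity_beta_normal_forms {S : Type} (Ar : S → S → Prop)
    (Rr : S → S → S → Prop) (hfun : FunctionalSpec Ar Rr)
    {Γ : List (ETm S)} {Δ : List (Tm (EConst S))} (hΓ : TransCtx Ar Rr Γ Δ)
    {A : ETm S} (hA : ETypeJ Ar Rr Γ A)
    {M T : Tm (EConst S)}
    (hT : (∃ s, A = ETm.sort s ∧ IsTopSort Ar s ∧ T = Ucon s) ∨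
          (∃ sA, ETyped Ar Rr Γ A (ETm.sort sA) ∧ T = Elcon sA (trans A)))
    (hnf : BetaNormal M)
    (h : Typed (sigEPTS Ar Rr) (rulesEPTS Ar Rr) Δ M T) :
    Invertible M ∧ ∃ M', inv M = some M' ∧ ETyped Ar Rr Γ M' A ∧
      HConv (rulesEPTS Ar Rr) (trans M') M := by
  have hType : TypeRel Ar Rr Γ A T := by
    rcases hT with ⟨s, rfl, -, rfl⟩ | ⟨s, hs, rfl⟩
    · exact .inl ⟨s, rfl, .refl _⟩
    · exact .inr ⟨s, hs, .refl _⟩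
  obtain ⟨E, hE, tE, cE⟩ := exists_invRel_of_typed (.of_transCtx hΓ) hType hnf h
  exact ⟨hE.invertible, E, hE.inv_eq, tE, cE⟩

end DKPaper
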